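/- Let g satisfy (g*), (g₀), (g∞) and let a be a locally integrable periodic function of minimal period T > 0 satisfying (a*). Then for every ρ > 0 there exists λ* > 0 such that for each λ > λ* there exist constants r, R with 0 < r < ρ < R and μ*(λ) > 0, all independent of k, such that for each μ > μ*(λ) and each integer k ≥ 2 the following holds: for every string S = (S₁,…,S_{km}) ∈ {0,1,2}^{km} with S ≠ (0,…,0) the equation u'' + (λa⁺(t) − μa⁻(t)) g(u) = 0 has a positive kT-periodic solution u such that, writing j = i + ℓm for i ∈ {1,…,m} and ℓ ∈ {0,…,k−1} and I⁺_{i,ℓ} := I⁺_i + ℓT: max_{t∈I⁺_{i,ℓ}} u(t) < r if S_j = 0; r < max_{t∈I⁺_{i,ℓ}} u(t) < ρ if S_j = 1; and ρ < max_{t∈I⁺_{i,ℓ}} u(t) < R if S_j = 2. In particular the equation has at least 3^{km} − 1 positive kT-periodic solutions. -/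

import Mathlib

open MeasureTheory Set Filter Topology

/-- A Carathéodory solution of `u'' + q(t) G(u) = 0` on all of `ℝ`:
`u` is `C¹` with derivative `v`, and `v t = v t₀ - ∫_{t₀}^{t} q s * G (u s) ds`. -/
def IsSolR (q G u v : ℝ → ℝ) : Prop :=
  (∀ t, HasDerivAt u (v t) t) ∧
    ∀ t₀ t : ℝ, v t = v t₀ - ∫ s in t₀..t, q s * G (u s)

section Scarf

/-- A map which identifies exactly one pair of points of a finite set. -/
theorem exists_pair_of_card_image {α β : Type*} [DecidableEq α] [DecidableEq β] (f : α → β) (s : Finset α)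
    (h : s.card = (s.image f).card + 1) :
    ∃ x₀ ∈ s, ∃ x₁ ∈ s, x₀ ≠ x₁ ∧ f x₀ = f x₁ ∧
      ∀ x ∈ s, ((s.erase x).image f = s.image f ↔ x = x₀ ∨ x = x₁) := by
  obtain ⟨x₀, h0, x₁, h1, hne, heq⟩ := Finset.exists_ne_map_eq_of_card_lt_of_maps_to
    (s := s) (t := s.image f) (f := f) (by omega) (fun x hx => Finset.mem_image_of_mem f hx)
  have key : ∀ x₀ ∈ s, ∀ x₁ ∈ s, x₀ ≠ x₁ → f x₀ = f x₁ → (s.erase x₀).image f = s.image f := by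
    intro x₀ h0 x₁ h1 hne heq
    ext y
    simp only [Finset.mem_image, Finset.mem_erase]
    constructor
    · rintro ⟨a, ⟨_, ha⟩, rfl⟩; exact ⟨a, ha, rfl⟩
    · rintro ⟨a, ha, rfl⟩
      by_cases h : a = x₀
      · exact ⟨x₁, ⟨hne.symm, h1⟩, by rw [h, heq]⟩
      · exact ⟨a, ⟨h, ha⟩, rfl⟩
  refine ⟨x₀, h0, x₁, h1, hne, heq, fun x hx => ⟨fun hi => ?_, ?_⟩⟩
  · by_contra hcon
    push Not at hcon
    have hcard : ((s.erase x).image f).card = (s.erase x).card := by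
      rw [hi, Finset.card_erase_of_mem hx]; omega
    have hinj := Finset.card_image_iff.1 hcard
    exact hne (hinj (by simp [h0, hcon.1.symm]) (by simp [h1, hcon.2.symm]) heq)
  · rintro (rfl | rfl)
    · exact key _ hx _ h1 hne heq
    · exact key _ hx _ h0 hne.symm heq.symm

/-- `X` dominates `V`: every point lies below all of `X` in at least one of the orderings `r i`. -/
def Dominating {ι V Λ : Type*} [LinearOrder Λ] (r : ι → V → Λ) (X : Finset V) : Prop :=
  ∀ y, ∃ i, ∀ x ∈ X, r i y ≤ r i x

theorem Dominating.mono {ι V Λ : Type*} [LinearOrder Λ] {r : ι → V → Λ} {X Y : Finset V}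
    (h : Dominating r X) (hYX : Y ⊆ X) : Dominating r Y := fun y => (h y).imp fun _ hi x hx => hi x (hYX hx)

/-- The points which can replace the index `a` as the place where a facet is completed. -/
def replacementSet {ι V Λ : Type*} [LinearOrder Λ] (r : ι → V → Λ) (mn : ι → V) (a : ι) : Set V :=
  {y | ∀ i, i ≠ a → r i (mn i) < r i y}

theorem exists_dominating_insert_iff {ι V Λ : Type*} [Fintype ι] [DecidableEq ι]
    [DecidableEq V] [LinearOrder Λ] {r : ι → V → Λ} (hr : ∀ i, Function.Injective (r i))
    {Y : Finset V} (hY : Y.Nonempty) (hdom : Dominating r Y)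
    (hcard : Fintype.card ι = Y.card + 1) :
    ∃ mn : ι → V, (∀ i, mn i ∈ Y ∧ ∀ y ∈ Y, r i (mn i) ≤ r i y) ∧
      ∃ i₁ i₂, i₁ ≠ i₂ ∧ mn i₁ = mn i₂ ∧
        ∀ x, (x ∉ Y ∧ Dominating r (insert x Y)) ↔ ∃ a, (a = i₁ ∨ a = i₂) ∧
          IsGreatest (r a '' replacementSet r mn a) (r a x) := by
  have hmn : ∀ i, ∃ y ∈ Y, ∀ y' ∈ Y, r i y ≤ r i y' := fun i => Finset.exists_min_image Y (r i) hY
  choose mn hmnY hmn using hmn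
  have hsurj : ∀ y ∈ Y, ∃ i, mn i = y := fun y hy => by
    obtain ⟨i, hi⟩ := hdom y
    exact ⟨i, hr i (le_antisymm (hmn i y hy) (hi _ (hmnY i)))⟩
  have himg : Finset.univ.image mn = Y := by
    ext y
    simp only [Finset.mem_image, Finset.mem_univ, true_and]
    exact ⟨by rintro ⟨i, rfl⟩; exact hmnY i, hsurj y⟩
  obtain ⟨i₁, -, i₂, -, hne, heq, hchar⟩ := exists_pair_of_card_image mn Finset.univ
    (by rw [himg, Finset.card_univ, hcard])
  refine ⟨mn, fun i => ⟨hmnY i, hmn i⟩, i₁, i₂, hne, heq, fun x => ⟨?_, ?_⟩⟩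
  · rintro ⟨hxY, hx⟩
    obtain ⟨a, ha⟩ := hx x
    have hax : r a x < r a (mn a) := by
      refine lt_of_le_of_ne (ha _ (Finset.mem_insert_of_mem (hmnY a))) fun h => hxY ?_
      rw [hr a h]; exact hmnY a
    have hother : ∀ y ∈ Y, ∃ i, i ≠ a ∧ mn i = y ∧ r i y ≤ r i x := by
      intro y hy
      obtain ⟨i, hi⟩ := hx y
      refine ⟨i, ?_, hr i (le_antisymm (hmn i y hy) (hi _ (Finset.mem_insert_of_mem (hmnY i)))),
        hi x (Finset.mem_insert_self _ _)⟩
      rintro rfl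
      exact absurd (hi x (Finset.mem_insert_self _ _)) (not_le.2 (hax.trans_le (hmn _ y hy)))
    have haim : (Finset.univ.erase a).image mn = Finset.univ.image mn := by
      rw [himg]
      ext y
      simp only [Finset.mem_image, Finset.mem_erase, Finset.mem_univ, and_true]
      refine ⟨by rintro ⟨i, -, rfl⟩; exact hmnY i, fun hy => ?_⟩
      obtain ⟨i, hi, hiy, -⟩ := hother y hy
      exact ⟨i, hi, hiy⟩
    have hinj : ∀ i j, i ≠ a → j ≠ a → mn i = mn j → i = j := by
      have hc : ((Finset.univ.erase a).image mn).card = (Finset.univ.erase a).card := by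
        rw [haim, himg, Finset.card_erase_of_mem (Finset.mem_univ _), Finset.card_univ, hcard]
        omega
      have := Finset.card_image_iff.1 hc
      exact fun i j hi hj h => this (by simp [hi]) (by simp [hj]) h
    have hxa : x ∈ replacementSet r mn a := by
      intro i hi
      obtain ⟨j, hj, hji, hle⟩ := hother (mn i) (hmnY i)
      obtain rfl := hinj i j hi hj hji.symm
      exact lt_of_le_of_ne hle fun h => hxY (by rw [← hr i h]; exact hmnY i)
    refine ⟨a, (hchar a (Finset.mem_univ _)).1 haim, ⟨x, hxa, rfl⟩, ?_⟩
    rintro _ ⟨z, hz, rfl⟩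
    obtain ⟨i, hi⟩ := hx z
    by_cases hia : i = a
    · subst hia; exact hi x (Finset.mem_insert_self _ _)
    · exact absurd (hi _ (Finset.mem_insert_of_mem (hmnY i))) (not_le.2 (hz i hia))
  · rintro ⟨a, ha, ⟨x', hx', hxx'⟩, hmax⟩
    obtain rfl := hr a hxx'
    have haim := (hchar a (Finset.mem_univ _)).2 ha
    rw [himg] at haim
    refine ⟨fun hxY => ?_, fun z => ?_⟩
    · rw [← haim] at hxY
      simp only [Finset.mem_image, Finset.mem_erase, Finset.mem_univ, and_true] at hxY
      obtain ⟨i, hi, hix⟩ := hxY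
      have := hx' i hi
      rw [hix] at this
      exact lt_irrefl _ this
    · by_cases hz : z ∈ replacementSet r mn a
      · refine ⟨a, fun y hy => ?_⟩
        obtain rfl | hy := Finset.mem_insert.1 hy
        · exact hmax ⟨z, hz, rfl⟩
        · obtain ⟨i, hi⟩ := hdom z
          by_cases hia : i = a
          · subst hia; exact hi y hy
          · exact absurd (hi _ (hmnY i)) (not_le.2 (hz i hia))
      · simp only [replacementSet, mem_ofPred_eq, not_forall, not_lt] at hz
        obtain ⟨i, hia, hi⟩ := hz
        refine ⟨i, fun y hy => ?_⟩
        obtain rfl | hy := Finset.mem_insert.1 hy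
        · exact hi.trans (hx' i hia).le
        · exact hi.trans (hmn i y hy)

/-- **Scarf's lemma**, with slack points `s i`. -/
theorem exists_dominating_colorful {ι V Λ : Type*} [Fintype ι] [DecidableEq ι] [Fintype V]
    [DecidableEq V] [LinearOrder Λ] (hι : 2 ≤ Fintype.card ι) {r : ι → V → Λ}
    (hr : ∀ i, Function.Injective (r i)) (s : ι → V) (hs : Function.Injective s)
    (hlow : ∀ i v, r i (s i) ≤ r i v)
    (hhigh : ∀ i j t, j ≠ i → t ∉ range s → r i t < r i (s j))
    {t₀ : V} (ht₀ : t₀ ∉ range s) (c : V → ι) (hc : ∀ i, c (s i) = i) :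
    ∃ X : Finset V, X.card = Fintype.card ι ∧ Dominating r X ∧ X.image c = Finset.univ := by
  classical
  by_contra hcon
  push Not at hcon
  obtain ⟨i₀⟩ : Nonempty ι := Fintype.card_pos_iff.1 (by omega)
  set R : Finset (Finset V) :=
    Finset.univ.filter fun X => X.card = Fintype.card ι ∧ Dominating r X with hR
  set D : Finset (Finset V) := Finset.univ.filter fun Y => Y.card + 1 = Fintype.card ι ∧
    Dominating r Y ∧ Y.image c = Finset.univ.erase i₀ with hD
  have hcount := Finset.sum_card_bipartiteAbove_eq_sum_card_bipartiteBelow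
    (s := R) (t := D) (fun X Y => Y ⊆ X)
  set Y₀ : Finset V := (Finset.univ.erase i₀).image s with hY₀
  have hY₀D : Y₀ ∈ D := by
    simp only [hD, Finset.mem_filter, Finset.mem_univ, true_and]
    refine ⟨?_, fun y => ?_, ?_⟩
    · rw [hY₀, Finset.card_image_of_injective _ hs, Finset.card_erase_of_mem (Finset.mem_univ _),
        Finset.card_univ]
      omega
    · by_cases hy : y ∈ range s
      · obtain ⟨j, rfl⟩ := hy
        exact ⟨j, fun x _ => hlow j x⟩
      · refine ⟨i₀, fun x hx => ?_⟩
        obtain ⟨j, hj, rfl⟩ := Finset.mem_image.1 hx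
        exact (hhigh i₀ j y (Finset.ne_of_mem_erase hj) hy).le
    · rw [hY₀, Finset.image_image]
      rw [show c ∘ s = id from funext hc, Finset.image_id]
  have hevenR : ∀ X ∈ R, Even (D.filter fun Y => Y ⊆ X).card := by
    intro X hX
    simp only [hR, Finset.mem_filter, Finset.mem_univ, true_and] at hX
    by_cases hne : (D.filter fun Y => Y ⊆ X).Nonempty
    swap
    · rw [Finset.not_nonempty_iff_eq_empty.1 hne]; simp
    obtain ⟨Y, hY⟩ := hne
    simp only [hD, Finset.mem_filter, Finset.mem_univ, true_and] at hY
    obtain ⟨⟨hYc, hYd, hYi⟩, hYX⟩ := hY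
    have hXi : X.image c = Finset.univ.erase i₀ := by
      refine Finset.Subset.antisymm (fun j hj => ?_) (hYi ▸ Finset.image_subset_image hYX)
      simp only [Finset.mem_erase, Finset.mem_univ, and_true]
      rintro rfl
      refine hcon X hX.1 hX.2 (Finset.eq_univ_of_forall fun l => ?_)
      by_cases hl : l = j
      · exact hl ▸ hj
      · exact Finset.image_subset_image hYX (hYi ▸ by simp [hl])
    obtain ⟨x₀, h0, x₁, h1, hne, heq, hchar⟩ := exists_pair_of_card_image c X
      (by rw [hXi, Finset.card_erase_of_mem (Finset.mem_univ _), Finset.card_univ, hX.1]; omega)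
    have : D.filter (fun Y => Y ⊆ X) = {X.erase x₀, X.erase x₁} := by
      ext Y
      simp only [hD, Finset.mem_filter, Finset.mem_univ, true_and, Finset.mem_insert,
        Finset.mem_singleton]
      constructor
      · rintro ⟨⟨hYc, hYd, hYi⟩, hYX⟩
        obtain ⟨x, hxY, hxX⟩ : ∃ x, x ∉ Y ∧ insert x Y = X := by
          have := (Finset.covBy_iff_card_sdiff_eq_one).2
            ⟨hYX, by rw [Finset.card_sdiff_of_subset hYX]; omega⟩
          obtain ⟨x, hx, h⟩ := Finset.covBy_iff_exists_insert.1 this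
          exact ⟨x, hx, h⟩
        have hYe : Y = X.erase x := by rw [← hxX, Finset.erase_insert hxY]
        have hx : x ∈ X := hxX ▸ Finset.mem_insert_self _ _
        rcases (hchar x hx).1 (by rw [← hYe, hYi, hXi]) with rfl | rfl
        · exact Or.inl hYe
        · exact Or.inr hYe
      · have aux : ∀ x ∈ X, (x = x₀ ∨ x = x₁) → ((X.erase x).card + 1 = Fintype.card ι ∧
            Dominating r (X.erase x) ∧ (X.erase x).image c = Finset.univ.erase i₀) ∧
            X.erase x ⊆ X := by
          intro x hx h
          refine ⟨⟨by rw [Finset.card_erase_of_mem hx]; omega,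
            hX.2.mono (Finset.erase_subset _ _), ?_⟩, Finset.erase_subset _ _⟩
          rw [(hchar x hx).2 h, hXi]
        rintro (rfl | rfl)
        · exact aux x₀ h0 (Or.inl rfl)
        · exact aux x₁ h1 (Or.inr rfl)
    rw [this, Finset.card_pair]
    · exact even_two
    · intro h
      have : x₀ ∈ X.erase x₁ := Finset.mem_erase.2 ⟨hne, h0⟩
      rw [← h] at this
      simp at this
  have hdoor : ∀ Y ∈ D, ∃ i₁ i₂ : ι, ∃ mn : ι → V,
      (∀ i, mn i ∈ Y ∧ ∀ y ∈ Y, r i (mn i) ≤ r i y) ∧ i₁ ≠ i₂ ∧ mn i₁ = mn i₂ ∧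
      (∀ x a, (a = i₁ ∨ a = i₂) → IsGreatest (r a '' replacementSet r mn a) (r a x) → x ∉ Y) ∧
      ∀ X, X ∈ R.filter (fun X => Y ⊆ X) ↔ ∃ x, X = insert x Y ∧ ∃ a, (a = i₁ ∨ a = i₂) ∧
          IsGreatest (r a '' replacementSet r mn a) (r a x) := by
    intro Y hY
    simp only [hD, Finset.mem_filter, Finset.mem_univ, true_and] at hY
    obtain ⟨hYc, hYd, hYi⟩ := hY
    obtain ⟨mn, hmn, i₁, i₂, hne, heq, hchar⟩ := exists_dominating_insert_iff hr
      (Finset.card_pos.1 (by omega)) hYd hYc.symm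
    refine ⟨i₁, i₂, mn, hmn, hne, heq,
      fun x a ha hx => ((hchar x).2 ⟨a, ha, hx⟩).1, fun X => ?_⟩
    simp only [hR, Finset.mem_filter, Finset.mem_univ, true_and]
    constructor
    · rintro ⟨⟨hXc, hXd⟩, hYX⟩
      have := (Finset.covBy_iff_card_sdiff_eq_one).2
            ⟨hYX, by rw [Finset.card_sdiff_of_subset hYX]; omega⟩
      obtain ⟨x, hx, rfl⟩ := Finset.covBy_iff_exists_insert.1 this
      exact ⟨x, rfl, (hchar x).1 ⟨hx, hXd⟩⟩
    · rintro ⟨x, rfl, ha⟩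
      have hx := ((hchar x).2 ha).1
      exact ⟨⟨by rw [Finset.card_insert_of_notMem hx]; omega, ((hchar x).2 ha).2⟩,
        Finset.subset_insert _ _⟩
  have hgreatest : ∀ (mn : ι → V) (a : ι), (replacementSet r mn a).Nonempty →
      ∃ x, IsGreatest (r a '' replacementSet r mn a) (r a x) := by
    intro mn a hne
    obtain ⟨x, hx, hmax⟩ := Set.exists_max_image _ (r a) (Set.toFinite (replacementSet r mn a)) hne
    exact ⟨x, ⟨x, hx, rfl⟩, by rintro _ ⟨z, hz, rfl⟩; exact hmax z hz⟩
  have hevenD : ∀ Y ∈ D.erase Y₀, Even (R.filter fun X => Y ⊆ X).card := by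
    intro Y hY
    obtain ⟨hYY₀, hYD⟩ := Finset.mem_erase.1 hY
    obtain ⟨i₁, i₂, mn, hmn, hne, heq, hnot, hchar⟩ := hdoor Y hYD
    simp only [hD, Finset.mem_filter, Finset.mem_univ, true_and] at hYD
    obtain ⟨hYc, hYd, hYi⟩ := hYD
    obtain ⟨t, htY, ht⟩ : ∃ t ∈ Y, t ∉ range s := by
      by_contra hall
      push Not at hall
      refine hYY₀ (Finset.eq_of_subset_of_card_le (fun y hy => ?_) ?_)
      · obtain ⟨j, rfl⟩ := hall y hy
        have : c (s j) ∈ Y.image c := Finset.mem_image_of_mem c hy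
        rw [hYi, hc] at this
        exact Finset.mem_image_of_mem s this
      · rw [hY₀, Finset.card_image_of_injective _ hs, Finset.card_erase_of_mem (Finset.mem_univ _),
          Finset.card_univ]
        omega
    have hslack : ∀ a, (replacementSet r mn a).Nonempty := fun a =>
      ⟨s a, fun i hi => ((hmn i).2 t htY).trans_lt (hhigh i a t hi.symm ht)⟩
    obtain ⟨x₁, hx₁⟩ := hgreatest mn i₁ (hslack i₁)
    obtain ⟨x₂, hx₂⟩ := hgreatest mn i₂ (hslack i₂)
    have huniq : ∀ {a x y}, IsGreatest (r a '' replacementSet r mn a) (r a x) →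
        IsGreatest (r a '' replacementSet r mn a) (r a y) → x = y :=
      fun hx hy => hr _ (hx.unique hy)
    have hx12 : x₁ ≠ x₂ := by
      rintro rfl
      obtain ⟨z, hz, hzx⟩ := hx₁.1
      obtain rfl := hr _ hzx
      obtain ⟨w, hw, hwx⟩ := hx₂.1
      obtain rfl := hr _ hwx
      obtain ⟨i, hi⟩ := hYd w
      have h1 := hi _ (hmn i).1
      by_cases h : i = i₁
      · exact absurd h1 (not_le.2 (hw i (h ▸ hne)))
      · exact absurd h1 (not_le.2 (hz i h))
    have : R.filter (fun X => Y ⊆ X) = {insert x₁ Y, insert x₂ Y} := by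
      ext X
      rw [hchar]
      simp only [Finset.mem_insert, Finset.mem_singleton]
      constructor
      · rintro ⟨x, rfl, a, rfl | rfl, hx⟩
        · exact Or.inl (by rw [huniq hx hx₁])
        · exact Or.inr (by rw [huniq hx hx₂])
      · rintro (rfl | rfl)
        · exact ⟨x₁, rfl, i₁, Or.inl rfl, hx₁⟩
        · exact ⟨x₂, rfl, i₂, Or.inr rfl, hx₂⟩
    rw [this, Finset.card_pair]
    · exact even_two
    · intro h
      have h1 : x₁ ∈ insert x₂ Y := h ▸ Finset.mem_insert_self _ _
      exact (Finset.mem_insert.1 h1).elim hx12 (hnot x₁ i₁ (Or.inl rfl) hx₁)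
  have hoddD : (R.filter fun X => Y₀ ⊆ X).card = 1 := by
    obtain ⟨i₁, i₂, mn, hmn, hne, heq, hnot, hchar⟩ := hdoor Y₀ hY₀D
    have hmns : ∀ i, i ≠ i₀ → mn i = s i := fun i hi => hr i (le_antisymm
      ((hmn i).2 _ (Finset.mem_image_of_mem s (by simp [hi]))) (hlow i _))
    obtain ⟨b, hb, hmb, hab⟩ : ∃ b, b ≠ i₀ ∧ mn i₀ = s b ∧
        ∀ a, (a = i₁ ∨ a = i₂) ↔ (a = i₀ ∨ a = b) := by
      by_cases h1 : i₁ = i₀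
      · subst h1
        exact ⟨i₂, hne.symm, by rw [heq, hmns _ hne.symm], fun a => Iff.rfl⟩
      · by_cases h2 : i₂ = i₀
        · subst h2
          exact ⟨i₁, hne, by rw [← heq, hmns _ hne], fun a => or_comm⟩
        · exact absurd (hs (by rw [← hmns _ h1, ← hmns _ h2, heq])) hne
    obtain ⟨x, hx⟩ := hgreatest mn i₀ ⟨t₀, fun i hi => by
      rw [hmns i hi]
      exact lt_of_le_of_ne (hlow i t₀) fun h => ht₀ ⟨i, hr i h⟩⟩
    have hbempty : ∀ y, y ∉ replacementSet r mn b := by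
      intro y hy
      have h0 := hy i₀ hb.symm
      rw [hmb] at h0
      by_cases hyr : y ∈ range s
      · obtain ⟨j, rfl⟩ := hyr
        by_cases hj : j = i₀
        · subst hj; exact absurd (hlow j (s b)) (not_le.2 h0)
        · by_cases hjb : j = b
          · subst hjb; exact lt_irrefl _ h0
          · have := hy j hjb
            rw [hmns j hj] at this
            exact lt_irrefl _ this
      · exact lt_asymm h0 (hhigh i₀ b y hb hyr)
    rw [Finset.card_eq_one]
    refine ⟨insert x Y₀, ?_⟩
    ext X
    rw [hchar, Finset.mem_singleton]
    constructor
    · rintro ⟨z, rfl, a, ha, hz⟩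
      rcases (hab a).1 ha with rfl | rfl
      · rw [hr _ (hz.unique hx)]
      · obtain ⟨y, hy, -⟩ := hz.1
        exact absurd hy (hbempty y)
    · rintro rfl
      exact ⟨x, rfl, i₀, (hab i₀).2 (Or.inl rfl), hx⟩
  have h1 : Even (∑ X ∈ R, (D.filter fun Y => Y ⊆ X).card) := Finset.even_sum _ hevenR
  have h2 : Odd (∑ Y ∈ D, (R.filter fun X => Y ⊆ X).card) := by
    rw [← Finset.sum_erase_add _ _ hY₀D, hoddD]
    exact (Finset.even_sum _ hevenD).add_one
  exact Nat.not_even_iff_odd.2 h2 (hcount ▸ h1)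

end Scarf

section Brouwer

/-- A discrete Brouwer theorem on the grid of the standard simplex with mesh `1 / N`. -/
theorem exists_grid_point_colors_near {ι : Type*} [Fintype ι] [DecidableEq ι]
    (hι : 2 ≤ Fintype.card ι) (N : ℕ) (c : (ι → ℕ) → ι) :
    ∃ x : ι → ℕ, ∑ i, x i = N ∧ ∀ i, x i ≤ Fintype.card ι ∨
      ∃ x' : ι → ℕ, ∑ i, x' i = N ∧ c x' = i ∧
        ∀ j, x j ≤ x' j + Fintype.card ι ∧ x' j ≤ x j + Fintype.card ι := by
  classical
  obtain ⟨i₀⟩ : Nonempty ι := Fintype.card_pos_iff.1 (by omega)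
  let G := {x : ι → Fin (N + 1) // ∑ i, (x i : ℕ) = N}
  let V := G ⊕ ι
  let code : V → ℕ := fun v => Fintype.equivFin V v
  have hcode : Function.Injective code := fun v w h =>
    (Fintype.equivFin V).injective (Fin.ext h)
  let lvl : ι → V → ℕ := fun i v => Sum.elim (fun t : G => (t.1 i : ℕ) + 1)
    (fun j => if j = i then 0 else N + 2) v
  let r : ι → V → ℕ ×ₗ ℕ := fun i v => toLex (lvl i v, code v)
  have hr : ∀ i, Function.Injective (r i) := fun i v w h => hcode (congrArg (fun p => (ofLex p).2) h)
  have hlt : ∀ i v w, lvl i v < lvl i w → r i v < r i w := fun i v w h =>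
    Prod.Lex.toLex_lt_toLex.2 (Or.inl h)
  have hle : ∀ i v w, r i v ≤ r i w → lvl i v ≤ lvl i w := fun i v w h => by
    rcases Prod.Lex.toLex_le_toLex.1 h with h | h
    · exact h.le
    · exact h.1.le
  have mkG : ∀ y : ι → ℕ, ∑ i, y i = N → ∃ t : G, ∀ i, (t.1 i : ℕ) = y i := by
    intro y hy
    have hy' : ∀ i, y i < N + 1 := fun i => Nat.lt_succ_of_le
      (hy ▸ Finset.single_le_sum (fun j _ => Nat.zero_le (y j)) (Finset.mem_univ i))
    exact ⟨⟨fun i => ⟨y i, hy' i⟩, hy⟩, fun i => rfl⟩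
  obtain ⟨t₀, ht₀⟩ := mkG (Pi.single i₀ N) (by simp)
  obtain ⟨X, hXc, hXd, hXi⟩ := exists_dominating_colorful hι hr (Sum.inr : ι → V)
    Sum.inr_injective
    (by
      rintro i (t | j)
      · exact (hlt _ _ _ (by simp [lvl])).le
      · by_cases h : j = i
        · rw [h]
        · exact (hlt _ _ _ (by simp [lvl, h])).le)
    (by
      rintro i j (t | l) hj ht
      · exact hlt _ _ _ (by simp only [lvl, Sum.elim_inl, Sum.elim_inr, if_neg hj]; omega)
      · exact absurd ⟨l, rfl⟩ ht)
    (t₀ := Sum.inl t₀) (by simp) (Sum.elim (fun t : G => c fun i => t.1 i) id) (fun i => rfl)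
  set C : Finset ι := Finset.univ.filter fun i => (Sum.inr i : V) ∉ X with hC
  have hdomC : ∀ y : ι → ℕ, ∑ i, y i = N → ∃ i ∈ C, ∀ t : G, Sum.inl t ∈ X → y i ≤ t.1 i := by
    intro y hy
    obtain ⟨t, ht⟩ := mkG y hy
    obtain ⟨i, hi⟩ := hXd (Sum.inl t)
    refine ⟨i, ?_, fun t' ht' => ?_⟩
    · simp only [hC, Finset.mem_filter, Finset.mem_univ, true_and]
      intro h
      simpa [lvl] using hle _ _ _ (hi _ h)
    · have := hle _ _ _ (hi _ ht')
      simp only [lvl, Sum.elim_inl, ht] at this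
      omega
  have hcol : ∀ i ∈ C, ∃ t : G, Sum.inl t ∈ X ∧ (c fun i => t.1 i) = i := by
    intro i hi
    have : i ∈ X.image (Sum.elim (fun t : G => c fun i => t.1 i) id) := by
      rw [hXi]; exact Finset.mem_univ i
    obtain ⟨t | j, hv, hvi⟩ := Finset.mem_image.1 this
    · exact ⟨t, hv, hvi⟩
    · simp only [hC, Finset.mem_filter, Finset.mem_univ, true_and] at hi
      simp only [Sum.elim_inr, id] at hvi
      exact absurd (hvi ▸ hv) hi
  obtain ⟨i₁, hi₁, -⟩ := hdomC (Pi.single i₀ N) (by simp)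
  obtain ⟨t₁, ht₁, -⟩ := hcol i₁ hi₁
  have hmin : ∀ i, ∃ t : G, Sum.inl t ∈ X ∧ ∀ t' : G, Sum.inl t' ∈ X → (t.1 i : ℕ) ≤ t'.1 i := by
    intro i
    obtain ⟨t, ht, h⟩ := Finset.exists_min_image (Finset.univ.filter fun t : G => Sum.inl t ∈ X)
      (fun t => (t.1 i : ℕ)) ⟨t₁, by simp [ht₁]⟩
    simp only [Finset.mem_filter, Finset.mem_univ, true_and] at ht h
    exact ⟨t, ht, h⟩
  choose mt hmtX hmt using hmin
  set m : ι → ℕ := fun i => (mt i).1 i with hm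
  have hsum : N < ∑ i ∈ C, (m i + 1) := by
    by_contra hcon
    push Not at hcon
    obtain ⟨d, hd⟩ := Nat.exists_eq_add_of_le hcon
    obtain ⟨i, hi, hle⟩ := hdomC
      (fun i => (if i ∈ C then m i + 1 else 0) + if i = i₀ then d else 0)
      (by rw [Finset.sum_add_distrib]; simp [hd])
    have := hle (mt i) (hmtX i)
    simp only [hi, if_true] at this
    have : m i = (mt i).1 i := rfl
    omega
  have hCcard : C.card ≤ Fintype.card ι := Finset.card_le_univ _
  rw [Finset.sum_add_distrib, Finset.sum_const, smul_eq_mul, mul_one] at hsum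
  have hbound : ∀ t : G, Sum.inl t ∈ X →
      ∀ j, (j ∈ C → (t.1 j : ℕ) ≤ m j + Fintype.card ι) ∧
        (j ∉ C → (t.1 j : ℕ) ≤ Fintype.card ι) := by
    intro t ht j
    have hge : ∀ i, m i ≤ t.1 i := fun i => hmt i t ht
    constructor
    · intro hj
      have h1 : ∑ i ∈ C, (t.1 i : ℕ) ≤ N := by
        conv_rhs => rw [← t.2]
        exact Finset.sum_le_sum_of_subset (Finset.subset_univ C)
      rw [← Finset.add_sum_erase _ _ hj] at h1 hsum
      have h2 : ∑ i ∈ C.erase j, m i ≤ ∑ i ∈ C.erase j, (t.1 i : ℕ) :=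
        Finset.sum_le_sum fun i _ => hge i
      omega
    · intro hj
      have h1 : ∑ i ∈ insert j C, (t.1 i : ℕ) ≤ N := by
        conv_rhs => rw [← t.2]
        exact Finset.sum_le_sum_of_subset (Finset.subset_univ _)
      rw [Finset.sum_insert hj] at h1
      have h2 : ∑ i ∈ C, m i ≤ ∑ i ∈ C, (t.1 i : ℕ) := Finset.sum_le_sum fun i _ => hge i
      omega
  refine ⟨fun i => t₁.1 i, t₁.2, fun i => ?_⟩
  by_cases hi : i ∈ C
  · obtain ⟨t, htX, hti⟩ := hcol i hi
    refine Or.inr ⟨fun i => t.1 i, t.2, hti, fun j => ?_⟩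
    have ha := hbound t htX j
    have hb := hbound t₁ ht₁ j
    have hc1 : m j ≤ t.1 j := hmt j t htX
    have hc2 : m j ≤ t₁.1 j := hmt j t₁ ht₁
    by_cases hj : j ∈ C
    · have := ha.1 hj; have := hb.1 hj; constructor <;> dsimp only <;> omega
    · have := ha.2 hj; have := hb.2 hj; constructor <;> dsimp only <;> omega
  · exact Or.inl ((hbound t₁ ht₁ i).2 hi)

/-- **Brouwer's fixed point theorem** for the standard simplex. -/
theorem exists_fixedPoint_stdSimplex {ι : Type*} [Fintype ι] [Nonempty ι]
    {f : (ι → ℝ) → ι → ℝ} (hf : ContinuousOn f (stdSimplex ℝ ι))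
    (hmaps : MapsTo f (stdSimplex ℝ ι) (stdSimplex ℝ ι)) :
    ∃ x ∈ stdSimplex ℝ ι, f x = x := by
  classical
  have hK := isCompact_stdSimplex ℝ ι
  have hge : ∀ x ∈ stdSimplex ℝ ι, (∀ i, x i ≤ f x i) → f x = x := by
    intro x hx h
    have hs : ∑ i, (f x i - x i) = 0 := by
      rw [Finset.sum_sub_distrib, (hmaps hx).2, hx.2, sub_self]
    funext i
    have := (Finset.sum_eq_zero_iff_of_nonneg fun i _ => sub_nonneg.2 (h i)).1 hs i
      (Finset.mem_univ i)
    linarith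
  have hne : (stdSimplex ℝ ι).Nonempty :=
    ⟨Pi.single (Classical.arbitrary ι) 1, single_mem_stdSimplex ℝ _⟩
  by_cases hι : 2 ≤ Fintype.card ι
  swap
  · obtain ⟨x, hx⟩ := hne
    refine ⟨x, hx, hge x hx fun i => ?_⟩
    have : Subsingleton ι := Fintype.card_le_one_iff_subsingleton.1 (by omega)
    have h1 := hx.2
    have h2 := (hmaps hx).2
    rw [Fintype.sum_subsingleton _ i] at h1 h2
    rw [h1, h2]
  have happrox : ∀ ε > 0, ∃ x ∈ stdSimplex ℝ ι, ∀ i, x i ≤ f x i + ε := by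
    intro ε hε
    obtain ⟨δ, hδ, hunif⟩ := Metric.uniformContinuousOn_iff.1
      (hK.uniformContinuousOn_of_continuous hf) (ε / 2) (by positivity)
    set n := Fintype.card ι
    obtain ⟨N, hN⟩ := exists_nat_gt ((n : ℝ) / min δ (ε / 2))
    have hmin : 0 < min δ (ε / 2) := lt_min hδ (by positivity)
    have hn : (0 : ℝ) < n := by exact_mod_cast (show 0 < n by omega)
    have hN0 : (0 : ℝ) < N := lt_of_le_of_lt (by positivity) hN
    have hsmall : (n : ℝ) / N < min δ (ε / 2) := by
      rw [div_lt_iff₀ hmin] at hN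
      rw [div_lt_iff₀ hN0]; linarith
    let pt : (ι → ℕ) → ι → ℝ := fun x i => x i / N
    have hpt : ∀ x : ι → ℕ, ∑ i, x i = N → pt x ∈ stdSimplex ℝ ι := by
      intro x hx
      refine ⟨fun i => by positivity, ?_⟩
      rw [← Finset.sum_div, ← Nat.cast_sum, hx, div_self hN0.ne']
    have hcolor : ∀ x : ι → ℕ, ∃ i, ∑ i, x i = N → pt x i ≤ f (pt x) i := by
      intro x
      by_cases hx : ∑ i, x i = N
      · by_contra hcon
        push Not at hcon
        have := Finset.sum_lt_sum_of_nonempty (s := Finset.univ) Finset.univ_nonempty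
          fun i _ => (hcon i).2
        rw [(hpt x hx).2, (hmaps (hpt x hx)).2] at this
        exact lt_irrefl _ this
      · exact ⟨Classical.arbitrary ι, fun h => absurd h hx⟩
    choose c hc using hcolor
    obtain ⟨x, hxN, hx⟩ := exists_grid_point_colors_near hι N c
    refine ⟨pt x, hpt x hxN, fun i => ?_⟩
    have hfx := (hmaps (hpt x hxN)).1 i
    rcases hx i with hxi | ⟨x', hx'N, hci, hnear⟩
    · have : pt x i ≤ n / N := by
        simp only [pt]; gcongr
      have := min_le_right δ (ε / 2)
      linarith
    · have hd : ∀ j, |pt x j - pt x' j| ≤ n / N := by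
        intro j
        simp only [pt, ← sub_div]
        rw [abs_div, abs_of_pos hN0]
        gcongr
        have h1 : (x j : ℝ) ≤ x' j + n := by exact_mod_cast (hnear j).1
        have h2 : (x' j : ℝ) ≤ x j + n := by exact_mod_cast (hnear j).2
        rw [abs_le]; constructor <;> linarith
      have hdist : dist (pt x) (pt x') < δ := by
        refine lt_of_le_of_lt ((dist_pi_le_iff (by positivity)).2 fun j => ?_)
          (hsmall.trans_le (min_le_left _ _))
        rw [Real.dist_eq]; exact hd j
      have hfd := (dist_le_pi_dist (f (pt x)) (f (pt x')) i).trans_lt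
        (hunif _ (hpt x hxN) _ (hpt x' hx'N) hdist)
      rw [Real.dist_eq, abs_lt] at hfd
      have h1 := hc x' hx'N
      rw [hci] at h1
      have h2 := abs_le.1 (hd i)
      have := min_le_right δ (ε / 2)
      linarith [hfd.1, h2.2]
  have hφ : ContinuousOn (fun x => ∑ i, max 0 (x i - f x i)) (stdSimplex ℝ ι) := by
    refine continuousOn_finsetSum _ fun i _ => ?_
    exact continuousOn_const.sup (((continuous_apply i).continuousOn).sub
      ((continuous_apply i).comp_continuousOn hf))
  obtain ⟨x, hx, hmin⟩ := hK.exists_isMinOn hne hφ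
  refine ⟨x, hx, hge x hx fun i => ?_⟩
  by_contra hcon
  push Not at hcon
  have hpos : 0 < ∑ i, max 0 (x i - f x i) := by
    refine lt_of_lt_of_le (b := max 0 (x i - f x i)) (by simp [hcon]) ?_
    exact Finset.single_le_sum (f := fun i => max 0 (x i - f x i))
      (fun j _ => le_max_left _ _) (Finset.mem_univ i)
  have hn : (0 : ℝ) < Fintype.card ι := by exact_mod_cast (show 0 < Fintype.card ι by omega)
  obtain ⟨y, hy, hyε⟩ := happrox ((∑ i, max 0 (x i - f x i)) / (2 * Fintype.card ι)) (by positivity)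
  have h1 : ∑ i, max 0 (x i - f x i) ≤ ∑ i, max 0 (y i - f y i) := hmin hy
  have h2 : ∑ i, max 0 (y i - f y i) ≤
      ∑ _i : ι, (∑ i, max 0 (x i - f x i)) / (2 * Fintype.card ι) :=
    Finset.sum_le_sum fun i _ => max_le (by positivity) (by linarith [hyε i])
  rw [Finset.sum_const, Finset.card_univ, nsmul_eq_mul] at h2
  have h3 : (Fintype.card ι : ℝ) * ((∑ i, max 0 (x i - f x i)) / (2 * Fintype.card ι)) =
      (∑ i, max 0 (x i - f x i)) / 2 := by field_simp
  linarith

/-- **Schauder's fixed point theorem** for a compact convex set in a normed space. -/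
theorem exists_fixedPoint_of_isCompact_convex {E : Type*} [NormedAddCommGroup E]
    [NormedSpace ℝ E] {K : Set E} (hK : IsCompact K) (hconv : Convex ℝ K) (hne : K.Nonempty)
    {f : E → E} (hf : ContinuousOn f K) (hmaps : MapsTo f K K) : ∃ x ∈ K, f x = x := by
  classical
  have happrox : ∀ ε > 0, ∃ x ∈ K, dist x (f x) ≤ ε := by
    intro ε hε
    obtain ⟨t, htK, htfin, hcover⟩ := hK.finite_cover_balls hε
    have : Fintype t := htfin.fintype
    have hcov : ∀ y ∈ K, ∃ i : t, dist y i < ε := by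
      intro y hy
      obtain ⟨i, hi, hyi⟩ := mem_iUnion₂.1 (hcover hy)
      exact ⟨⟨i, hi⟩, hyi⟩
    obtain ⟨i₀, -⟩ := hcov _ hne.some_mem
    have : Nonempty t := ⟨i₀⟩
    let wt : t → E → ℝ := fun i y => max 0 (ε - dist y i)
    have hwt0 : ∀ i y, 0 ≤ wt i y := fun i y => le_max_left _ _
    have hwtc : ∀ i, Continuous (wt i) := fun i => by fun_prop
    have hsum : ∀ y ∈ K, 0 < ∑ i, wt i y := by
      intro y hy
      obtain ⟨i, hi⟩ := hcov y hy
      exact Finset.sum_pos' (fun i _ => hwt0 i y) ⟨i, Finset.mem_univ i, by simp [wt, hi]⟩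
    let comb : (t → ℝ) → E := fun z => ∑ i, z i • (i : E)
    have hcombc : Continuous comb := by fun_prop
    have hcombK : ∀ z ∈ stdSimplex ℝ t, comb z ∈ K := fun z hz =>
      hconv.sum_mem (fun i _ => hz.1 i) hz.2 fun i _ => htK i.2
    let F : (t → ℝ) → t → ℝ := fun z i => wt i (f (comb z)) / ∑ j, wt j (f (comb z))
    have hfc : ContinuousOn (fun z => f (comb z)) (stdSimplex ℝ t) :=
      hf.comp hcombc.continuousOn hcombK
    obtain ⟨z, hz, hzF⟩ := exists_fixedPoint_stdSimplex (f := F)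
      (continuousOn_pi.2 fun i => ((hwtc i).comp_continuousOn hfc).div
        (continuousOn_finsetSum _ fun j _ => (hwtc j).comp_continuousOn hfc)
        fun z hz => (hsum _ (hmaps (hcombK z hz))).ne')
      (fun z hz => ⟨fun i => div_nonneg (hwt0 _ _) (Finset.sum_nonneg fun j _ => hwt0 j _), by
        rw [← Finset.sum_div, div_self (hsum _ (hmaps (hcombK z hz))).ne']⟩)
    refine ⟨comb z, hcombK z hz, ?_⟩
    have hdiff : comb z - f (comb z) = ∑ i, z i • ((i : E) - f (comb z)) := by
      simp only [smul_sub, Finset.sum_sub_distrib, ← Finset.sum_smul, hz.2, one_smul]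
      rfl
    rw [dist_eq_norm, hdiff]
    calc ‖∑ i, z i • ((i : E) - f (comb z))‖ ≤ ∑ i, ‖z i • ((i : E) - f (comb z))‖ :=
          norm_sum_le _ _
      _ ≤ ∑ i, z i * ε := by
          refine Finset.sum_le_sum fun i _ => ?_
          rw [norm_smul, Real.norm_of_nonneg (hz.1 i)]
          by_cases hi : dist (f (comb z)) i < ε
          · refine mul_le_mul_of_nonneg_left ?_ (hz.1 i)
            rw [← dist_eq_norm, dist_comm]; exact hi.le
          · have : z i = 0 := by
              rw [← hzF]
              simp only [F, wt]
              rw [max_eq_left (by linarith), zero_div]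
            simp [this]
      _ = ε := by rw [← Finset.sum_mul, hz.2, one_mul]
  have hφ : ContinuousOn (fun x => dist x (f x)) K := continuous_dist.comp_continuousOn (continuousOn_id.prodMk hf)
  obtain ⟨x, hx, hmin⟩ := hK.exists_isMinOn hne hφ
  refine ⟨x, hx, ?_⟩
  by_contra hcon
  have hpos : 0 < dist x (f x) := dist_pos.2 (Ne.symm hcon)
  obtain ⟨y, hy, hyd⟩ := happrox _ (half_pos hpos)
  have h1 : dist x (f x) ≤ dist y (f y) := hmin hy
  linarith

end Brouwer

theorem isCompact_setOf_lipschitz_addCircle {P : ℝ} [Fact (0 < P)] (L C : ℝ) :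
    IsCompact {w : BoundedContinuousFunction (AddCircle P) ℝ |
      (∀ x y : ℝ, |w (x : AddCircle P) - w (y : AddCircle P)| ≤ L * |x - y|) ∧
        ∀ x, |w x| ≤ C} := by
  refine BoundedContinuousFunction.arzela_ascoli₂ (Icc (-C) C) isCompact_Icc _ ?_ ?_ ?_
  · simp only [ofPred_and, ofPred_forall]
    refine IsClosed.inter (isClosed_iInter fun x => isClosed_iInter fun y => ?_)
      (isClosed_iInter fun x => ?_)
    · exact isClosed_le (by fun_prop) (by fun_prop)
    · exact isClosed_le (by fun_prop) (by fun_prop)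
  · intro f x hf
    exact abs_le.1 (hf.2 x)
  · refine Metric.equicontinuous_of_continuity_modulus (fun d => L * d) ?_ _ ?_
    · have : Tendsto (fun d : ℝ => L * d) (𝓝 0) (𝓝 (L * 0)) :=
        tendsto_id.const_mul L
      simpa using this
    · rintro x y ⟨f, hf⟩
      induction x using QuotientAddGroup.induction_on with | H x => ?_
      induction y using QuotientAddGroup.induction_on with | H y => ?_
      have h1 : ((y + round (P⁻¹ * (x - y)) * P : ℝ) : AddCircle P) = (y : AddCircle P) := by
        rw [AddCircle.coe_add, ← zsmul_eq_mul, AddCircle.coe_zsmul, AddCircle.coe_period]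
        simp
      have h2 := hf.1 x (y + round (P⁻¹ * (x - y)) * P)
      rw [h1] at h2
      rw [Real.dist_eq, dist_eq_norm, ← AddCircle.coe_sub, AddCircle.norm_eq]
      refine h2.trans (le_of_eq ?_)
      congr 2
      ring

/-- The primitive of `f` vanishing at `0`, corrected by a linear term so that it is `P`-periodic
whenever `f` is. -/
noncomputable def periodicPrimitive (P : ℝ) (f : ℝ → ℝ) (t : ℝ) : ℝ :=
  (∫ s in (0 : ℝ)..t, f s) - t / P * ∫ s in (0 : ℝ)..P, f s

theorem periodicPrimitive_zero (P : ℝ) (f : ℝ → ℝ) : periodicPrimitive P f 0 = 0 := by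
  simp [periodicPrimitive]

theorem periodic_periodicPrimitive {P : ℝ} (hP : 0 < P) {f : ℝ → ℝ}
    (hf : ∀ a b, IntervalIntegrable f volume a b) (hper : Function.Periodic f P) :
    Function.Periodic (periodicPrimitive P f) P := by
  intro t
  have h := hper.intervalIntegral_add_eq_add 0 t hf
  rw [zero_add] at h
  simp only [periodicPrimitive, h]
  field_simp
  ring

theorem continuous_periodicPrimitive {P : ℝ} {f : ℝ → ℝ}
    (hf : ∀ a b, IntervalIntegrable f volume a b) : Continuous (periodicPrimitive P f) := by
  unfold periodicPrimitive
  have := intervalIntegral.continuous_primitive hf 0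
  fun_prop

theorem hasDerivAt_periodicPrimitive {P : ℝ} {f : ℝ → ℝ} (hf : Continuous f) (t : ℝ) :
    HasDerivAt (periodicPrimitive P f) (f t - 1 / P * ∫ s in (0 : ℝ)..P, f s) t := by
  unfold periodicPrimitive
  exact (hf.integral_hasStrictDerivAt 0 t).hasDerivAt.sub
    (((hasDerivAt_id t).div_const P).mul_const _)

theorem abs_periodicPrimitive_le {P : ℝ} (hP : 0 < P) {f : ℝ → ℝ}
    (hf : ∀ a b, IntervalIntegrable f volume a b) (hper : Function.Periodic f P) (t : ℝ) :
    |periodicPrimitive P f t| ≤ 2 * ∫ s in (0 : ℝ)..P, |f s| := by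
  obtain ⟨y, hy, hty⟩ := (periodic_periodicPrimitive hP hf hper).exists_mem_Ico₀ hP t
  rw [hty]
  have h1 : |∫ s in (0 : ℝ)..y, f s| ≤ ∫ s in (0 : ℝ)..P, |f s| :=
    (intervalIntegral.abs_integral_le_integral_abs hy.1).trans
      (intervalIntegral.integral_mono_interval le_rfl hy.1 hy.2.le
        (Eventually.of_forall fun s => abs_nonneg _) (hf 0 P).abs)
  have h2 : |∫ s in (0 : ℝ)..P, f s| ≤ ∫ s in (0 : ℝ)..P, |f s| :=
    intervalIntegral.abs_integral_le_integral_abs hP.le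
  have h3 : |y / P| ≤ 1 := by
    rw [abs_of_nonneg (div_nonneg hy.1 hP.le)]
    exact (div_le_one hP).2 hy.2.le
  calc |periodicPrimitive P f y|
      ≤ |∫ s in (0 : ℝ)..y, f s| + |y / P * ∫ s in (0 : ℝ)..P, f s| := abs_sub _ _
    _ ≤ (∫ s in (0 : ℝ)..P, |f s|) + 1 * ∫ s in (0 : ℝ)..P, |f s| := by
        rw [abs_mul]
        gcongr
    _ = _ := by ring

theorem periodicPrimitive_sub {P : ℝ} {f g : ℝ → ℝ}
    (hf : ∀ a b, IntervalIntegrable f volume a b)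
    (hg : ∀ a b, IntervalIntegrable g volume a b) :
    periodicPrimitive P (fun t => f t - g t) =
      fun t => periodicPrimitive P f t - periodicPrimitive P g t := by
  funext t
  simp only [periodicPrimitive, intervalIntegral.integral_sub (hf _ _) (hg _ _)]
  ring

theorem abs_periodicPrimitive_periodicPrimitive_le {P : ℝ} (hP : 0 < P) {f : ℝ → ℝ}
    (hf : ∀ a b, IntervalIntegrable f volume a b) (hper : Function.Periodic f P) (t : ℝ) :
    |periodicPrimitive P (periodicPrimitive P f) t| ≤
      4 * P * ∫ s in (0 : ℝ)..P, |f s| := by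
  have hc := continuous_periodicPrimitive (P := P) hf
  refine (abs_periodicPrimitive_le hP (fun _ _ => hc.intervalIntegrable _ _)
    (periodic_periodicPrimitive hP hf hper) t).trans ?_
  have : ∫ s in (0 : ℝ)..P, |periodicPrimitive P f s| ≤
      ∫ s in (0 : ℝ)..P, 2 * ∫ s in (0 : ℝ)..P, |f s| :=
    intervalIntegral.integral_mono_on hP.le (hc.abs.intervalIntegrable _ _)
      intervalIntegrable_const fun s _ => abs_periodicPrimitive_le hP hf hper s
  rw [intervalIntegral.integral_const, smul_eq_mul] at this
  linarith

theorem abs_periodicPrimitive_periodicPrimitive_sub_le {P : ℝ} (hP : 0 < P) {f : ℝ → ℝ}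
    (hf : ∀ a b, IntervalIntegrable f volume a b) (hper : Function.Periodic f P) (x y : ℝ) :
    |periodicPrimitive P (periodicPrimitive P f) x -
      periodicPrimitive P (periodicPrimitive P f) y| ≤
      (4 * ∫ s in (0 : ℝ)..P, |f s|) * |x - y| := by
  have hc := continuous_periodicPrimitive (P := P) hf
  have hb := abs_periodicPrimitive_le hP hf hper
  refine Convex.norm_image_sub_le_of_norm_hasDerivWithin_le (s := univ)
    (fun t _ => (hasDerivAt_periodicPrimitive hc t).hasDerivWithinAt) (fun t _ => ?_)
    convex_univ (mem_univ _) (mem_univ _)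
  have h1 : ‖∫ s in (0 : ℝ)..P, periodicPrimitive P f s‖ ≤
      (2 * ∫ s in (0 : ℝ)..P, |f s|) * |P - 0| :=
    intervalIntegral.norm_integral_le_of_norm_le_const fun s _ => hb s
  rw [sub_zero, abs_of_pos hP, Real.norm_eq_abs] at h1
  have h2 : |1 / P * ∫ s in (0 : ℝ)..P, periodicPrimitive P f s| ≤
      2 * ∫ s in (0 : ℝ)..P, |f s| := by
    rw [abs_mul, abs_of_pos (by positivity : 0 < 1 / P), one_div, inv_mul_le_iff₀ hP]
    linarith
  rw [Real.norm_eq_abs]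
  refine (abs_sub _ _).trans ?_
  linarith [hb t]

/-- The constant `c` minus the iterated periodic primitive of `f`, as a function on the circle. -/
noncomputable def periodicGreen (P : ℝ) [hP : Fact (0 < P)] (f : ℝ → ℝ)
    (hf : ∀ a b, IntervalIntegrable f volume a b) (hper : Function.Periodic f P) (c : ℝ) :
    BoundedContinuousFunction (AddCircle P) ℝ :=
  BoundedContinuousFunction.mkOfCompact
    ⟨Function.Periodic.lift (f := fun t => c - periodicPrimitive P (periodicPrimitive P f) t)
      (c := P) (fun t => by
        have hc := continuous_periodicPrimitive (P := P) hf
        have := periodic_periodicPrimitive hP.out (fun _ _ => hc.intervalIntegrable _ _)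
          (periodic_periodicPrimitive hP.out hf hper) t
        simp only [this]),
      continuous_coinduced_dom.2 (by
        have hc := continuous_periodicPrimitive (P := P)
          (fun _ _ => (continuous_periodicPrimitive (P := P) hf).intervalIntegrable _ _)
        exact continuous_const.sub hc)⟩

theorem periodicGreen_apply (P : ℝ) [hP : Fact (0 < P)] (f : ℝ → ℝ)
    (hf : ∀ a b, IntervalIntegrable f volume a b) (hper : Function.Periodic f P) (c t : ℝ) :
    periodicGreen P f hf hper c (t : AddCircle P) =
      c - periodicPrimitive P (periodicPrimitive P f) t := rfl

theorem exists_periodic_solution {ι : Type*} [Fintype ι] {P : ℝ} [hP : Fact (0 < P)]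
    {h : (BoundedContinuousFunction (AddCircle P) ℝ) × (ι → ℝ) → ℝ → ℝ} {b : ℝ → ℝ}
    (hmeas : ∀ x, AEStronglyMeasurable (h x) volume)
    (hper : ∀ x, Function.Periodic (h x) P)
    (hbound : ∀ x t, |h x t| ≤ b t) (hb : IntervalIntegrable b volume 0 P)
    (hcont : ∀ t, Continuous fun x => h x t)
    {Ψ : (BoundedContinuousFunction (AddCircle P) ℝ) × (ι → ℝ) → ι → ℝ}
    (hΨ : Continuous Ψ) {lo hi : ι → ℝ} (hΨmem : ∀ x, Ψ x ∈ Icc lo hi)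
    {X₀ : ℝ} (hX₀ : 0 < X₀)
    (hneg : ∀ x, (∀ t : ℝ, X₀ ≤ x.1 (t : AddCircle P)) → ∫ t in (0 : ℝ)..P, h x t < 0)
    (hpos : ∀ x, (∀ t : ℝ, x.1 (t : AddCircle P) ≤ -X₀) → 0 < ∫ t in (0 : ℝ)..P, h x t) :
    ∃ x, Ψ x = x.2 ∧ ∃ v : ℝ → ℝ,
      (∀ t : ℝ, HasDerivAt (fun s : ℝ => x.1 (s : AddCircle P)) (v t) t) ∧
        ∀ t₀ t : ℝ, v t = v t₀ - ∫ s in t₀..t, h x s := by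
  have hP0 : 0 < P := hP.out
  have hint0 : ∀ x, IntervalIntegrable (h x) volume 0 P := fun x =>
    hb.mono_fun (hmeas x).restrict (Eventually.of_forall fun t =>
      (hbound x t).trans (le_abs_self _))
  have hint : ∀ x a b, IntervalIntegrable (h x) volume a b := fun x a b =>
    (hper x).intervalIntegrable (t := 0) hP0.ne' (by simpa using hint0 x) a b
  set B := ∫ t in (0 : ℝ)..P, b t with hB
  have hle : ∀ x, ∫ t in (0 : ℝ)..P, |h x t| ≤ B := fun x =>
    intervalIntegral.integral_mono_on hP0.le (hint0 x).abs hb fun t _ => hbound x t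
  have hB0 : 0 ≤ B := by
    obtain ⟨p⟩ : Nonempty (ι → ℝ) := ⟨0⟩
    exact (intervalIntegral.integral_nonneg hP0.le fun t _ => abs_nonneg _).trans (hle (0, p))
  set X := X₀ + 4 * P * B with hX
  have hXpos : 0 < X := by positivity
  set c : (BoundedContinuousFunction (AddCircle P) ℝ) × (ι → ℝ) → ℝ := fun x =>
    max (-X) (min X (x.1 ((0 : ℝ) : AddCircle P) + ∫ t in (0 : ℝ)..P, h x t)) with hc
  set Φ : (BoundedContinuousFunction (AddCircle P) ℝ) × (ι → ℝ) →
      (BoundedContinuousFunction (AddCircle P) ℝ) × (ι → ℝ) := fun x =>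
    (periodicGreen P (h x) (hint x) (hper x) (c x), Ψ x) with hΦ
  have hcX : ∀ x, |c x| ≤ X := fun x =>
    abs_le.2 ⟨le_max_left _ _, max_le (by linarith) (min_le_left _ _)⟩
  have hgreen : ∀ x t, |periodicPrimitive P (periodicPrimitive P (h x)) t| ≤ 4 * P * B :=
    fun x t => (abs_periodicPrimitive_periodicPrimitive_le hP0 (hint x) (hper x) t).trans
      (by have := hle x; gcongr)
  set K : Set ((BoundedContinuousFunction (AddCircle P) ℝ) × (ι → ℝ)) :=
    {w : BoundedContinuousFunction (AddCircle P) ℝ |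
      (∀ x y : ℝ, |w (x : AddCircle P) - w (y : AddCircle P)| ≤ 4 * B * |x - y|) ∧
        ∀ x, |w x| ≤ X + 4 * P * B} ×ˢ Icc lo hi with hK
  have hKcpt : IsCompact K := (isCompact_setOf_lipschitz_addCircle _ _).prod isCompact_Icc
  have hKconv : Convex ℝ K := by
    refine Convex.prod ?_ (convex_Icc _ _)
    rintro f ⟨hf1, hf2⟩ g ⟨hg1, hg2⟩ s t hs ht hst
    refine ⟨fun x y => ?_, fun x => ?_⟩
    · have e : (s • f + t • g) (x : AddCircle P) - (s • f + t • g) (y : AddCircle P) =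
          s * (f x - f y) + t * (g x - g y) := by
        simp only [BoundedContinuousFunction.coe_add, BoundedContinuousFunction.coe_smul,
          Pi.add_apply, smul_eq_mul]
        ring
      rw [e]
      refine (abs_add_le _ _).trans ?_
      rw [abs_mul, abs_mul, abs_of_nonneg hs, abs_of_nonneg ht]
      calc _ ≤ s * (4 * B * |x - y|) + t * (4 * B * |x - y|) := by
            gcongr
            exacts [hf1 x y, hg1 x y]
        _ = (s + t) * (4 * B * |x - y|) := by ring
        _ = _ := by rw [hst, one_mul]
    · have e : (s • f + t • g) x = s * f x + t * g x := by
        simp only [BoundedContinuousFunction.coe_add, BoundedContinuousFunction.coe_smul,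
          Pi.add_apply, smul_eq_mul]
      rw [e]
      refine (abs_add_le _ _).trans ?_
      rw [abs_mul, abs_mul, abs_of_nonneg hs, abs_of_nonneg ht]
      calc _ ≤ s * (X + 4 * P * B) + t * (X + 4 * P * B) := by
            gcongr
            exacts [hf2 x, hg2 x]
        _ = (s + t) * (X + 4 * P * B) := by ring
        _ = _ := by rw [hst, one_mul]
  have hmaps : ∀ x, Φ x ∈ K := by
    intro x
    refine ⟨⟨fun s t => ?_, fun s => ?_⟩, hΨmem x⟩
    · simp only [hΦ, periodicGreen_apply]
      rw [sub_sub_sub_cancel_left, abs_sub_comm]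
      refine (abs_periodicPrimitive_periodicPrimitive_sub_le hP0 (hint x) (hper x) s t).trans ?_
      have := hle x
      gcongr
    · induction s using QuotientAddGroup.induction_on with | H s => ?_
      simp only [hΦ, periodicGreen_apply]
      exact (abs_sub _ _).trans (add_le_add (hcX x) (hgreen x s))
  have hdist : ∀ x₀, Tendsto (fun x => ∫ t in (0 : ℝ)..P, |h x t - h x₀ t|) (𝓝 x₀) (𝓝 0) := by
    intro x₀
    have : ContinuousAt (fun x => ∫ t in (0 : ℝ)..P, |h x t - h x₀ t|) x₀ := by
      refine intervalIntegral.continuousAt_of_dominated_interval (bound := fun t => 2 * b t)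
        (Eventually.of_forall fun x => ((hmeas x).sub (hmeas x₀)).norm.restrict)
        (Eventually.of_forall fun x => Eventually.of_forall fun t _ => ?_) (hb.const_mul 2)
        (Eventually.of_forall fun t _ => ?_)
      · rw [Real.norm_eq_abs, abs_abs]
        refine (abs_sub _ _).trans ?_
        linarith [hbound x t, hbound x₀ t]
      · exact (((hcont t).sub continuous_const).abs).continuousAt
    simpa [ContinuousAt] using this
  have hIcont : Continuous fun x => ∫ t in (0 : ℝ)..P, h x t := by
    refine continuous_iff_continuousAt.2 fun x₀ =>
      intervalIntegral.continuousAt_of_dominated_interval (bound := b)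
        (Eventually.of_forall fun x => (hmeas x).restrict)
        (Eventually.of_forall fun x => Eventually.of_forall fun t _ => hbound x t) hb
        (Eventually.of_forall fun t _ => (hcont t).continuousAt)
  have hccont : Continuous c := by
    simp only [hc]
    have : Continuous fun x : (BoundedContinuousFunction (AddCircle P) ℝ) × (ι → ℝ) =>
        x.1 ((0 : ℝ) : AddCircle P) := by fun_prop
    fun_prop
  have hΦcont : Continuous Φ := by
    refine Continuous.prodMk ?_ hΨ
    refine continuous_iff_continuousAt.2 fun x₀ => ?_
    refine tendsto_iff_dist_tendsto_zero.2 ?_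
    have hlim : Tendsto (fun x => |c x - c x₀| + 4 * P * ∫ t in (0 : ℝ)..P, |h x t - h x₀ t|)
        (𝓝 x₀) (𝓝 0) := by
      have h1 : Tendsto (fun x => |c x - c x₀|) (𝓝 x₀) (𝓝 0) := by
        have : ContinuousAt (fun x => |c x - c x₀|) x₀ := by fun_prop
        simpa [ContinuousAt] using this
      simpa using h1.add ((hdist x₀).const_mul (4 * P))
    refine squeeze_zero (fun _ => dist_nonneg) (fun x => ?_) hlim
    refine (BoundedContinuousFunction.dist_le ?_).2 fun s => ?_
    · have : 0 ≤ ∫ t in (0 : ℝ)..P, |h x t - h x₀ t| :=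
        intervalIntegral.integral_nonneg hP0.le fun t _ => abs_nonneg _
      positivity
    · induction s using QuotientAddGroup.induction_on with | H s => ?_
      have hsub := abs_periodicPrimitive_periodicPrimitive_le hP0
        (f := fun t => h x t - h x₀ t) (fun a b => (hint x a b).sub (hint x₀ a b))
        (fun t => by simp only [hper x t, hper x₀ t]) s
      rw [periodicPrimitive_sub (hint x) (hint x₀), periodicPrimitive_sub
        (fun _ _ => (continuous_periodicPrimitive (hint x)).intervalIntegrable _ _)
        (fun _ _ => (continuous_periodicPrimitive (hint x₀)).intervalIntegrable _ _)] at hsub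
      rw [Real.dist_eq]
      simp only [periodicGreen_apply]
      rw [sub_sub_sub_comm]
      exact (abs_sub _ _).trans (add_le_add le_rfl hsub)
  obtain ⟨x, -, hx⟩ := exists_fixedPoint_of_isCompact_convex hKcpt hKconv ⟨_, hmaps (0, 0)⟩
    hΦcont.continuousOn fun x _ => hmaps x
  have hx1 : ∀ t : ℝ, x.1 (t : AddCircle P) =
      c x - periodicPrimitive P (periodicPrimitive P (h x)) t := fun t => by
    conv_lhs => rw [← hx]
    rfl
  have hx0 : x.1 ((0 : ℝ) : AddCircle P) = c x := by
    rw [hx1, periodicPrimitive_zero, sub_zero]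
  have hI : ∫ t in (0 : ℝ)..P, h x t = 0 := by
    have hcx : c x = max (-X) (min X (c x + ∫ t in (0 : ℝ)..P, h x t)) := by
      conv_lhs => simp only [hc]
      rw [hx0]
    rcases lt_trichotomy (∫ t in (0 : ℝ)..P, h x t) 0 with hlt | heq | hgt
    · have : c x = -X := by
        rcases max_choice (-X) (min X (c x + ∫ t in (0 : ℝ)..P, h x t)) with e | e
        · rw [hcx, e]
        · have := min_le_right X (c x + ∫ t in (0 : ℝ)..P, h x t)
          linarith
      refine absurd (hpos x fun t => ?_) hlt.not_gt
      rw [hx1, this]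
      linarith [(abs_le.1 (hgreen x t)).1]
    · exact heq
    · have : c x = X := by
        have h1 := le_max_right (-X) (min X (c x + ∫ t in (0 : ℝ)..P, h x t))
        rcases min_choice X (c x + ∫ t in (0 : ℝ)..P, h x t) with e | e
        · exact le_antisymm (abs_le.1 (hcX x)).2 (by linarith)
        · linarith
      refine absurd (hneg x fun t => ?_) hgt.not_gt
      rw [hx1, this]
      linarith [(abs_le.1 (hgreen x t)).2]
  have hc1 := continuous_periodicPrimitive (P := P) (hint x)
  refine ⟨x, congrArg Prod.snd hx, fun t => -(periodicPrimitive P (h x) t -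
    1 / P * ∫ s in (0 : ℝ)..P, periodicPrimitive P (h x) s), fun t => ?_, fun t₀ t => ?_⟩
  · have : (fun s : ℝ => x.1 (s : AddCircle P)) =
        fun s => c x - periodicPrimitive P (periodicPrimitive P (h x)) s := funext hx1
    rw [this]
    exact (hasDerivAt_periodicPrimitive hc1 t).const_sub _
  · have := intervalIntegral.integral_add_adjacent_intervals (hint x 0 t₀) (hint x t₀ t)
    simp only [periodicPrimitive, hI, mul_zero, sub_zero]
    linarith

/-- `u` is a `C¹` function with derivative `v`, and `v' = -h` in the Carathéodory sense. -/
structure IsSecondPrimitive (u v h : ℝ → ℝ) : Prop where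
  hasDerivAt : ∀ t, HasDerivAt u (v t) t
  deriv_eq : ∀ t₀ t, v t = v t₀ - ∫ s in t₀..t, h s
  intervalIntegrable : ∀ s t, IntervalIntegrable h volume s t

/-- `[s, t]` is an interval on which `b` is nonnegative and has a definite amount of mass at
distance at least `η` from the end points. -/
structure IsBump (η : ℝ) (b : ℝ → ℝ) (s t : ℝ) : Prop where
  le : s + η ≤ t - η
  nonneg : ∀ᵐ x, x ∈ Icc s t → 0 ≤ b x
  le_integral : η ≤ ∫ x in (s + η)..(t - η), max (b x) 0

theorem IsBump.neg_reflect {η : ℝ} {b : ℝ → ℝ} {s t : ℝ} (hb : IsBump η b s t) :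
    IsBump η (fun x => b (-x)) (-t) (-s) where
  le := by linarith [hb.le]
  nonneg := by
    have := (Measure.measurePreserving_neg (volume : Measure ℝ)).quasiMeasurePreserving.ae
      hb.nonneg
    filter_upwards [this] with x hx hxm
    exact hx ⟨by linarith [hxm.2], by linarith [hxm.1]⟩
  le_integral := by
    have := intervalIntegral.integral_comp_neg (a := -t + η) (b := -s - η)
      (fun x => max (b x) 0)
    rw [this]
    convert hb.le_integral using 2 <;> ring

theorem IsBump.add_period {η : ℝ} {b : ℝ → ℝ} {s t c : ℝ} (hper : ∀ x, b (x + c) = b x)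
    (hb : IsBump η b s t) : IsBump η b (s + c) (t + c) where
  le := by linarith [hb.le]
  nonneg := by
    have := (measurePreserving_add_right (volume : Measure ℝ) (-c)).quasiMeasurePreserving.ae
      hb.nonneg
    filter_upwards [this] with x hx hxm
    have h1 := hx ⟨by linarith [hxm.1], by linarith [hxm.2]⟩
    rwa [← hper, neg_add_cancel_right] at h1
  le_integral := by
    have := intervalIntegral.integral_comp_add_right (a := s + η) (b := t - η)
      (fun x => max (b x) 0) c
    simp only [hper] at this
    rw [show s + c + η = s + η + c by ring, show t + c - η = t - η + c by ring, ← this]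
    exact hb.le_integral

theorem integral_mono_of_ae_Icc {f k : ℝ → ℝ} {s t : ℝ} (hst : s ≤ t)
    (hf : IntervalIntegrable f volume s t) (hk : IntervalIntegrable k volume s t)
    (hle : ∀ᵐ x, x ∈ Icc s t → f x ≤ k x) : ∫ x in s..t, f x ≤ ∫ x in s..t, k x :=
  intervalIntegral.integral_mono_ae_restrict hst hf hk
    ((ae_restrict_iff' measurableSet_Icc).2 hle)

namespace IsSecondPrimitive

variable {u v h : ℝ → ℝ}

theorem continuous (H : IsSecondPrimitive u v h) : Continuous u :=
  continuous_iff_continuousAt.2 fun t => (H.hasDerivAt t).continuousAt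

theorem continuous_deriv (H : IsSecondPrimitive u v h) : Continuous v := by
  have : v = fun t => v 0 - ∫ s in (0 : ℝ)..t, h s := funext fun t => H.deriv_eq 0 t
  rw [this]
  exact continuous_const.sub (intervalIntegral.continuous_primitive H.intervalIntegrable 0)

theorem mul_sub_le (H : IsSecondPrimitive u v h) {s t c : ℝ} (hst : s ≤ t)
    (hv : ∀ x ∈ Icc s t, c ≤ v x) : c * (t - s) ≤ u t - u s := by
  rcases hst.eq_or_lt with rfl | hlt
  · simp
  · obtain ⟨x, hx, hxe⟩ := exists_hasDerivAt_eq_slope u v hlt H.continuous.continuousOn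
      fun x _ => H.hasDerivAt x
    have := hv x (Ioo_subset_Icc_self hx)
    rw [hxe, le_div_iff₀ (sub_pos.2 hlt)] at this
    exact this

theorem sub_le_mul (H : IsSecondPrimitive u v h) {s t c : ℝ} (hst : s ≤ t)
    (hv : ∀ x ∈ Icc s t, v x ≤ c) : u t - u s ≤ c * (t - s) := by
  rcases hst.eq_or_lt with rfl | hlt
  · simp
  · obtain ⟨x, hx, hxe⟩ := exists_hasDerivAt_eq_slope u v hlt H.continuous.continuousOn
      fun x _ => H.hasDerivAt x
    have := hv x (Ioo_subset_Icc_self hx)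
    rw [hxe, div_le_iff₀ (sub_pos.2 hlt)] at this
    exact this

theorem neg_reflect (H : IsSecondPrimitive u v h) :
    IsSecondPrimitive (fun t => u (-t)) (fun t => -v (-t)) (fun t => h (-t)) where
  hasDerivAt t := by
    have := (H.hasDerivAt (-t)).comp t (hasDerivAt_neg t)
    rw [mul_neg_one] at this
    exact this
  deriv_eq t₀ t := by
    rw [intervalIntegral.integral_comp_neg]
    have := H.deriv_eq (-t) (-t₀)
    linarith
  intervalIntegrable s t := by
    have := (H.intervalIntegrable (-s) (-t)).comp_sub_left 0
    simpa using this

theorem deriv_le_of_nonneg (H : IsSecondPrimitive u v h) {s t : ℝ} (hst : s ≤ t)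
    (hh : ∀ᵐ x, x ∈ Icc s t → 0 ≤ h x) : v t ≤ v s := by
  have := integral_mono_of_ae_Icc hst intervalIntegrable_const (H.intervalIntegrable s t) hh
  rw [intervalIntegral.integral_zero] at this
  linarith [H.deriv_eq s t]

theorem le_deriv_of_nonpos (H : IsSecondPrimitive u v h) {s t : ℝ} (hst : s ≤ t)
    (hh : ∀ᵐ x, x ∈ Icc s t → h x ≤ 0) : v s ≤ v t := by
  have := integral_mono_of_ae_Icc hst (H.intervalIntegrable s t) intervalIntegrable_const hh
  rw [intervalIntegral.integral_zero] at this
  linarith [H.deriv_eq s t]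

/-- A concave function that is pushed down by at least `K b` on a bump of `b` has to be large. -/
theorem exists_le_of_isBump (H : IsSecondPrimitive u v h) {b : ℝ → ℝ} {η s t K : ℝ}
    (hη : 0 < η) (hK : 0 ≤ K) (hb : IsBump η b s t)
    (hbi : IntervalIntegrable b volume (s + η) (t - η))
    (hu : ∀ x ∈ Icc s t, 0 ≤ u x) (h0 : ∀ᵐ x, x ∈ Icc s t → 0 ≤ h x)
    (h1 : ∀ᵐ x, x ∈ Icc (s + η) (t - η) → K * max (b x) 0 ≤ h x) :
    ∃ x ∈ Icc s t, K * η ^ 2 / 2 ≤ u x := by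
  have hle := hb.le
  have hanti : ∀ x ∈ Icc s t, ∀ y ∈ Icc s t, x ≤ y → v y ≤ v x := fun x hx y hy hxy =>
    H.deriv_le_of_nonneg hxy (h0.mono fun z hz hzm => hz ⟨hx.1.trans hzm.1, hzm.2.trans hy.2⟩)
  have hdrop : K * η ≤ v (s + η) - v (t - η) := by
    have hbm : IntervalIntegrable (fun x => max (b x) 0) volume (s + η) (t - η) :=
      ⟨hbi.1.sup (integrable_zero _ _ _), hbi.2.sup (integrable_zero _ _ _)⟩
    have := integral_mono_of_ae_Icc hle (hbm.const_mul K) (H.intervalIntegrable _ _) h1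
    rw [intervalIntegral.integral_const_mul] at this
    have h2 := mul_le_mul_of_nonneg_left hb.le_integral hK
    linarith [H.deriv_eq (s + η) (t - η)]
  by_cases hv : K * η / 2 ≤ v (s + η)
  · have hmem : s + η ∈ Icc s t := ⟨by linarith, by linarith⟩
    refine ⟨s + η, hmem, ?_⟩
    have := H.mul_sub_le (s := s) (t := s + η) (c := K * η / 2) (by linarith) fun x hx =>
      hv.trans (hanti x ⟨hx.1, hx.2.trans hmem.2⟩ _ hmem hx.2)
    have h0 := hu s ⟨le_rfl, by linarith⟩
    nlinarith
  · have hmem : t - η ∈ Icc s t := ⟨by linarith, by linarith⟩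
    refine ⟨t - η, hmem, ?_⟩
    have := H.sub_le_mul (s := t - η) (t := t) (c := -(K * η / 2)) (by linarith) fun x hx =>
      (hanti _ hmem x ⟨hmem.1.trans hx.1, hx.2⟩ hx.1).trans (by linarith)
    have h0 := hu t ⟨by linarith, le_rfl⟩
    nlinarith

/-- A nonnegative concave function is bounded below away from the end points of its interval. -/
theorem mul_le_mul_of_concave (H : IsSecondPrimitive u v h) {η s t T x y : ℝ}
    (hη : 0 < η) (htT : t - s ≤ T)
    (hu : ∀ x ∈ Icc s t, 0 ≤ u x) (h0 : ∀ᵐ x, x ∈ Icc s t → 0 ≤ h x)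
    (hy : y ∈ Icc s t) (hx : x ∈ Icc (s + η) (t - η)) : u y * η ≤ u x * T := by
  have hanti : ∀ x ∈ Icc s t, ∀ y ∈ Icc s t, x ≤ y → v y ≤ v x := fun x hx y hy hxy =>
    H.deriv_le_of_nonneg hxy (h0.mono fun z hz hzm => hz ⟨hx.1.trans hzm.1, hzm.2.trans hy.2⟩)
  have hxm : x ∈ Icc s t := ⟨by linarith [hx.1], by linarith [hx.2]⟩
  have hux := hu x hxm
  have huy := hu y hy
  rcases le_total x y with hxy | hxy
  · have h1 := H.mul_sub_le (s := s) (t := x) (c := v x) hxm.1 fun z hz =>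
      hanti z ⟨hz.1, hz.2.trans hxm.2⟩ x hxm hz.2
    have h2 := H.sub_le_mul (s := x) (t := y) (c := v x) hxy fun z hz =>
      hanti x hxm z ⟨hxm.1.trans hz.1, hz.2.trans hy.2⟩ hz.1
    have h3 := hu s ⟨le_rfl, hxm.1.trans hxm.2⟩
    have h4 := mul_le_mul_of_nonneg_right h1 (sub_nonneg.2 hxy)
    have h5 := mul_le_mul_of_nonneg_right h2 (sub_nonneg.2 hxm.1)
    have h6 := mul_nonneg h3 (sub_nonneg.2 hxy)
    have h7 : u y * η ≤ u y * (x - s) := mul_le_mul_of_nonneg_left (by linarith [hx.1]) huy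
    have h8 : u x * (y - s) ≤ u x * T := mul_le_mul_of_nonneg_left (by linarith [hy.2]) hux
    nlinarith
  · have h1 := H.sub_le_mul (s := x) (t := t) (c := v x) hxm.2 fun z hz =>
      hanti x hxm z ⟨hxm.1.trans hz.1, hz.2⟩ hz.1
    have h2 := H.mul_sub_le (s := y) (t := x) (c := v x) hxy fun z hz =>
      hanti z ⟨hy.1.trans hz.1, hz.2.trans hxm.2⟩ x hxm hz.2
    have h3 := hu t ⟨hxm.1.trans hxm.2, le_rfl⟩
    have h4 := mul_le_mul_of_nonneg_right h1 (sub_nonneg.2 hxy)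
    have h5 := mul_le_mul_of_nonneg_right h2 (sub_nonneg.2 hxm.2)
    have h6 := mul_nonneg h3 (sub_nonneg.2 hxy)
    have h7 : u y * η ≤ u y * (t - x) := mul_le_mul_of_nonneg_left (by linarith [hx.2]) huy
    have h8 : u x * (t - y) ≤ u x * T := mul_le_mul_of_nonneg_left (by linarith [hy.1]) hux
    nlinarith

/-- If `u` is nondecreasing at `s`, loses at most slope `E` on `[s, τ]` and is pushed up strongly
on the following interval `[τ, t]`, then it is large at `t`. -/
theorem le_of_isBump_right (H : IsSecondPrimitive u v h) {b : ℝ → ℝ} {η s τ t E N : ℝ}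
    (hη : 0 < η) (hE : 0 ≤ E) (hN : 0 ≤ N) (hsτ : s ≤ τ) (hvs : 0 ≤ v s) (hb : IsBump η b τ t)
    (hbi : ∀ x y, IntervalIntegrable b volume x y)
    (h1 : ∀ x ∈ Icc s τ, ∫ y in s..x, h y ≤ E)
    (h2 : ∀ᵐ x, x ∈ Icc τ t → h x ≤ 0)
    (h3 : ∀ᵐ x, x ∈ Icc τ t → u s - E * (t - s) ≤ u x → h x ≤ -N * max (b x) 0) :
    u s - E * (t - s) + N * η ^ 2 ≤ u t := by
  have hle := hb.le
  have hmono : ∀ x ∈ Icc τ t, ∀ y ∈ Icc τ t, x ≤ y → v x ≤ v y := fun x hx y hy hxy =>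
    H.le_deriv_of_nonpos hxy (h2.mono fun z hz hzm => hz ⟨hx.1.trans hzm.1, hzm.2.trans hy.2⟩)
  have hτt : τ ≤ t := by linarith
  have hv1 : ∀ x ∈ Icc s τ, -E ≤ v x := fun x hx => by
    have := h1 x hx
    linarith [H.deriv_eq s x]
  have hv2 : ∀ x ∈ Icc s t, -E ≤ v x := fun x hx => by
    rcases le_total x τ with hxτ | hxτ
    · exact hv1 x ⟨hx.1, hxτ⟩
    · exact (hv1 τ ⟨hsτ, le_rfl⟩).trans (hmono τ ⟨le_rfl, hτt⟩ x ⟨hxτ, hx.2⟩ hxτ)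
  have hlow : ∀ x ∈ Icc s t, u s - E * (x - s) ≤ u x := fun x hx => by
    have := H.mul_sub_le hx.1 fun y hy => hv2 y ⟨hy.1, hy.2.trans hx.2⟩
    linarith
  have h3' : ∀ᵐ x, x ∈ Icc (τ + η) (t - η) → h x ≤ -N * max (b x) 0 := by
    filter_upwards [h3] with x hx hxm
    have hxm' : x ∈ Icc τ t := ⟨by linarith [hxm.1], by linarith [hxm.2]⟩
    refine hx hxm' ?_
    have := hlow x ⟨hsτ.trans hxm'.1, hxm'.2⟩
    nlinarith [hxm'.2]
  have hrise : N * η ≤ v (t - η) - v (τ + η) := by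
    have hbm : IntervalIntegrable (fun x => max (b x) 0) volume (τ + η) (t - η) :=
      ⟨(hbi _ _).1.sup (integrable_zero _ _ _), (hbi _ _).2.sup (integrable_zero _ _ _)⟩
    have := integral_mono_of_ae_Icc hle (H.intervalIntegrable _ _) (hbm.const_mul (-N)) h3'
    rw [intervalIntegral.integral_const_mul] at this
    have h2 := mul_le_mul_of_nonneg_left hb.le_integral hN
    linarith [H.deriv_eq (τ + η) (t - η)]
  have hv3 : ∀ x ∈ Icc (t - η) t, N * η - E ≤ v x := fun x hx => by
    have e1 := hmono (t - η) ⟨by linarith, by linarith⟩ x ⟨by linarith [hx.1], hx.2⟩ hx.1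
    have e2 := hv2 (τ + η) ⟨by linarith, by linarith⟩
    linarith
  have e1 := H.mul_sub_le (s := t - η) (t := t) (by linarith) hv3
  have e2 := hlow (t - η) ⟨by linarith, by linarith⟩
  nlinarith

theorem le_of_isBump_left (H : IsSecondPrimitive u v h) {b : ℝ → ℝ} {η s t N : ℝ}
    (hη : 0 < η) (hN : 0 ≤ N) (hvt : v t ≤ 0) (hb : IsBump η b s t)
    (hbi : ∀ x y, IntervalIntegrable b volume x y)
    (h2 : ∀ᵐ x, x ∈ Icc s t → h x ≤ 0)
    (h3 : ∀ᵐ x, x ∈ Icc s t → u t ≤ u x → h x ≤ -N * max (b x) 0) :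
    u t + N * η ^ 2 ≤ u s := by
  have hq := (Measure.measurePreserving_neg (volume : Measure ℝ)).quasiMeasurePreserving
  have := H.neg_reflect.le_of_isBump_right (s := -t) (E := 0) hη le_rfl hN le_rfl
    (by simpa using hvt) hb.neg_reflect
    (fun x y => by simpa using (hbi (-x) (-y)).comp_sub_left 0)
    (fun x hx => by
      obtain rfl : x = -t := le_antisymm hx.2 hx.1
      simp)
    (by
      filter_upwards [hq.ae h2] with x hx hxm
      exact hx ⟨by linarith [hxm.2], by linarith [hxm.1]⟩)
    (by
      filter_upwards [hq.ae h3] with x hx hxm hux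
      exact hx ⟨by linarith [hxm.2], by linarith [hxm.1]⟩ (by simpa using hux))
  simpa using this

theorem nonneg_of_periodic (H : IsSecondPrimitive u v h) {P : ℝ} (hP : 0 < P)
    (hper : Function.Periodic u P) (hh : ∀ t, u t < 0 → min 1 (-u t) ≤ h t) (t : ℝ) :
    0 ≤ u t := by
  obtain ⟨t₀, -, ht₀⟩ := isCompact_Icc.exists_isMinOn (nonempty_Icc.2 hP.le)
    (H.continuous.continuousOn (s := Icc 0 P))
  have hmin : ∀ t, u t₀ ≤ u t := fun t => by
    obtain ⟨y, hy, hty⟩ := hper.exists_mem_Ico₀ hP t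
    rw [hty]
    exact ht₀ (Ico_subset_Icc_self hy)
  by_contra! hneg
  have hlt : u t₀ < 0 := (hmin t).trans_lt hneg
  have hv0 : v t₀ = 0 :=
    IsLocalMin.hasDerivAt_eq_zero (Eventually.of_forall hmin) (H.hasDerivAt t₀)
  set c := min 1 (-u t₀ / 2) with hc
  have hcpos : 0 < c := lt_min one_pos (by linarith)
  obtain ⟨δ, hδ, hball⟩ := Metric.eventually_nhds_iff.1
    (H.continuous.continuousAt.eventually_lt (continuousAt_const (y := u t₀ / 2))
      (by linarith : u t₀ < u t₀ / 2))
  have hlow : ∀ x ∈ Icc t₀ (t₀ + δ / 2), c ≤ h x := fun x hx => by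
    have h1 : u x < u t₀ / 2 := hball (by
      rw [Real.dist_eq, abs_of_nonneg (by linarith [hx.1])]
      linarith [hx.2])
    exact (min_le_min le_rfl (by linarith)).trans (hh x (by linarith))
  have hv : ∀ x ∈ Icc t₀ (t₀ + δ / 2), v x ≤ -(c * (x - t₀)) := fun x hx => by
    have := integral_mono_of_ae_Icc hx.1 intervalIntegrable_const (H.intervalIntegrable t₀ x)
      (Eventually.of_forall fun y hy => hlow y ⟨hy.1, hy.2.trans hx.2⟩)
    rw [intervalIntegral.integral_const, smul_eq_mul] at this
    linarith [H.deriv_eq t₀ x]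
  have e1 := H.sub_le_mul (s := t₀) (t := t₀ + δ / 4) (c := 0) (by linarith) fun x hx =>
    (hv x ⟨hx.1, by linarith [hx.2]⟩).trans (by nlinarith [hx.1])
  have e2 := H.sub_le_mul (s := t₀ + δ / 4) (t := t₀ + δ / 2) (c := -(c * (δ / 4)))
    (by linarith) fun x hx =>
    (hv x ⟨by linarith [hx.1], hx.2⟩).trans (by nlinarith [hx.1])
  have := hmin (t₀ + δ / 2)
  have : 0 < c * (δ / 4) * (δ / 4) := by positivity
  nlinarith

theorem deriv_nonneg_of_isMaxOn (H : IsSecondPrimitive u v h) {s t : ℝ} (hst : s < t)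
    (hmax : ∀ x ∈ Icc s t, u x ≤ u t) : 0 ≤ v t := by
  by_contra! hv
  obtain ⟨δ, hδ, hball⟩ := Metric.eventually_nhds_iff.1
    (H.continuous_deriv.continuousAt.eventually_lt (continuousAt_const (y := v t / 2))
      (by linarith : v t < v t / 2))
  set x := max s (t - δ / 2) with hx
  have hxt : x < t := max_lt hst (by linarith)
  have hxs : t - δ / 2 ≤ x := le_max_right _ _
  have := H.sub_le_mul hxt.le fun y hy => (hball (y := y) (by
    rw [Real.dist_eq, abs_of_nonpos (by linarith [hy.2])]
    linarith [hy.1])).le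
  have h2 := hmax x ⟨le_max_left _ _, hxt.le⟩
  nlinarith

theorem deriv_nonpos_of_isMaxOn (H : IsSecondPrimitive u v h) {s t : ℝ} (hst : s < t)
    (hmax : ∀ x ∈ Icc s t, u x ≤ u s) : v s ≤ 0 := by
  have := H.neg_reflect.deriv_nonneg_of_isMaxOn (s := -t) (t := -s) (by linarith)
    fun x hx => by simpa using hmax (-x) ⟨by linarith [hx.2], by linarith [hx.1]⟩
  simpa using this

end IsSecondPrimitive

/-- A nonnegative solution of `u'' + C λ a⁺ G(u) + D a⁺ - μ a⁻ G(u) = 0` with coefficients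
`0 ≤ C ≤ 1` and `0 ≤ D ≤ A`. -/
structure IsModifiedSolution (a G C D u v h : ℝ → ℝ) (lam mu A : ℝ) : Prop
    extends IsSecondPrimitive u v h where
  nonneg : ∀ t, 0 ≤ u t
  G_nonneg : ∀ s, 0 ≤ G s
  C_mem : ∀ t, C t ∈ Icc 0 1
  D_mem : ∀ t, D t ∈ Icc 0 A
  lam_nonneg : 0 ≤ lam
  mu_nonneg : 0 ≤ mu
  integrable : ∀ s t, IntervalIntegrable a volume s t
  eq : ∀ t, h t = C t * (lam * max (a t) 0 * G (u t)) + D t * max (a t) 0 -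
    mu * max (-a t) 0 * G (u t)

namespace IsModifiedSolution

variable {a G C D u v h : ℝ → ℝ} {lam mu A : ℝ}

theorem nonneg_of_isBump (H : IsModifiedSolution a G C D u v h lam mu A) {η s t : ℝ}
    (hb : IsBump η a s t) : ∀ᵐ x, x ∈ Icc s t → 0 ≤ h x := by
  filter_upwards [hb.nonneg] with x hx hxm
  have h1 := hx hxm
  rw [H.eq, max_eq_left h1, max_eq_right (by linarith : -a x ≤ 0)]
  have := H.G_nonneg (u x)
  have := (H.C_mem x).1
  have := (H.D_mem x).1
  have := H.lam_nonneg
  have : 0 ≤ C x * (lam * a x * G (u x)) + D x * a x := by positivity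
  linarith

theorem eq_of_isBump_neg (H : IsModifiedSolution a G C D u v h lam mu A) {η s t : ℝ}
    (hb : IsBump η (fun x => -a x) s t) :
    ∀ᵐ x, x ∈ Icc s t → h x = -(mu * G (u x)) * max (-a x) 0 := by
  filter_upwards [hb.nonneg] with x hx hxm
  have h1 := hx hxm
  rw [H.eq, max_eq_right (by linarith : a x ≤ 0)]
  ring

theorem nonpos_of_isBump_neg (H : IsModifiedSolution a G C D u v h lam mu A) {η s t : ℝ}
    (hb : IsBump η (fun x => -a x) s t) : ∀ᵐ x, x ∈ Icc s t → h x ≤ 0 := by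
  filter_upwards [H.eq_of_isBump_neg hb] with x hx hxm
  rw [hx hxm, neg_mul]
  have := H.G_nonneg (u x)
  have := H.mu_nonneg
  have : 0 ≤ mu * G (u x) * max (-a x) 0 := by positivity
  linarith

theorem le_neg_mul_of_isBump_neg (H : IsModifiedSolution a G C D u v h lam mu A)
    {η s t c γ : ℝ} (hb : IsBump η (fun x => -a x) s t) (hγ : ∀ y, c ≤ y → γ ≤ G y) :
    ∀ᵐ x, x ∈ Icc s t → c ≤ u x → h x ≤ -(mu * γ) * max (-a x) 0 := by
  filter_upwards [H.eq_of_isBump_neg hb] with x hx hxm hcx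
  rw [hx hxm]
  have := hγ _ hcx
  have := H.mu_nonneg
  gcongr

theorem integral_le (H : IsModifiedSolution a G C D u v h lam mu A) {T Abar e s t : ℝ}
    (hA : ∀ x y, x ≤ y → y - x ≤ T → ∫ z in x..y, |a z| ≤ Abar) (he : 0 ≤ e) (hst : s ≤ t)
    (htT : t - s ≤ T) (hle : ∀ x ∈ Icc s t, C x * (lam * G (u x)) + D x ≤ e) :
    ∫ x in s..t, h x ≤ e * Abar := by
  have h1 := integral_mono_of_ae_Icc hst (H.intervalIntegrable s t)
    ((H.integrable s t).abs.const_mul e) (Eventually.of_forall fun x hx => ?_)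
  · rw [intervalIntegral.integral_const_mul] at h1
    exact h1.trans (mul_le_mul_of_nonneg_left (hA s t hst htT) he)
  · have h2 := hle x hx
    rw [H.eq]
    have h3 : max (a x) 0 ≤ |a x| := max_le (le_abs_self _) (abs_nonneg _)
    have h4 : 0 ≤ mu * max (-a x) 0 * G (u x) := by
      have := H.G_nonneg (u x)
      have := H.mu_nonneg
      positivity
    have h5 : (C x * (lam * G (u x)) + D x) * max (a x) 0 ≤ e * |a x| :=
      mul_le_mul h2 h3 (le_max_right _ _) he
    linarith

/-- The solution stays below `R` if the negative part of the weight is strong enough. -/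
theorem lt_of_periodic (H : IsModifiedSolution a G C D u v h lam mu A)
    {η T P Abar e γ R : ℝ} (hη : 0 < η) (hP : 0 < P) (hper : Function.Periodic u P)
    (hA : ∀ x y, x ≤ y → y - x ≤ T → ∫ z in x..y, |a z| ≤ Abar) (hA0 : 0 ≤ Abar)
    (hcover : ∀ t, ∃ s τ s', IsBump η a s τ ∧ IsBump η (fun x => -a x) τ s' ∧
      t ∈ Icc s s' ∧ s' - s ≤ T)
    (hRpos : 0 ≤ R) (he : 0 ≤ e) (hGe : ∀ s, lam * G s + A ≤ e) (heR : e * Abar * T ≤ R / 2)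
    (hγ0 : 0 ≤ γ) (hγ : ∀ y, R / 2 ≤ y → γ ≤ G y) (hmu : R < mu * γ * η ^ 2)
    (t : ℝ) : u t < R := by
  obtain ⟨t₀, -, ht₀⟩ := isCompact_Icc.exists_isMaxOn (nonempty_Icc.2 hP.le)
    (H.continuous.continuousOn (s := Icc 0 P))
  have hmax : ∀ t, u t ≤ u t₀ := fun t => by
    obtain ⟨y, hy, hty⟩ := hper.exists_mem_Ico₀ hP t
    rw [hty]
    exact ht₀ (Ico_subset_Icc_self hy)
  by_contra! hR
  have hR0 : R ≤ u t₀ := hR.trans (hmax t)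
  have hv0 : ∀ x, (∀ t, u t ≤ u x) → v x = 0 := fun x hx =>
    IsLocalMax.hasDerivAt_eq_zero (Eventually.of_forall hx) (H.hasDerivAt x)
  obtain ⟨s, τ, s', hb1, hb2, ht₀m, hT⟩ := hcover t₀
  obtain ⟨x₀, hx₀m, hx₀⟩ : ∃ x₀ ∈ Icc s τ, u x₀ = u t₀ := by
    rcases le_total t₀ τ with hle | hle
    · exact ⟨t₀, ⟨ht₀m.1, hle⟩, rfl⟩
    · refine ⟨τ, ⟨by linarith [hb1.le], le_rfl⟩, le_antisymm (hmax τ) ?_⟩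
      have := H.sub_le_mul (s := τ) (t := t₀) (c := 0) hle fun x hx => by
        have := H.le_deriv_of_nonpos hx.2 ((H.nonpos_of_isBump_neg hb2).mono fun z hz hzm =>
          hz ⟨hx.1.trans hzm.1, hzm.2.trans ht₀m.2⟩)
        rwa [hv0 t₀ hmax] at this
      linarith
  have hx0s' : x₀ ≤ s' := by linarith [hx₀m.2, hb2.le]
  have hbound : e * Abar * (s' - x₀) ≤ R / 2 := by
    refine le_trans ?_ heR
    have := hx₀m.1
    gcongr
    linarith
  have := H.le_of_isBump_right (s := x₀) (E := e * Abar) (N := mu * γ) hη (by positivity)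
    (mul_nonneg H.mu_nonneg hγ0) hx₀m.2 (hv0 x₀ (by rwa [hx₀])).ge hb2
    (fun x y => (H.integrable x y).neg)
    (fun x hx => H.integral_le hA he hx.1 (by linarith [hx.2, hx₀m.1, hb2.le])
      fun y _ => le_trans ?_ (hGe (u y)))
    (H.nonpos_of_isBump_neg hb2)
    (H.le_neg_mul_of_isBump_neg hb2 fun y hy => hγ y (by linarith))
  · linarith [hmax s']
  · have h1 := H.C_mem y
    have h2 := H.D_mem y
    have h3 := mul_nonneg H.lam_nonneg (H.G_nonneg (u y))
    nlinarith [h1.2, h2.2]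

/-- A solution whose push on a positive bump is weak cannot have a maximum there that is not
small, as it would escape to large values on an adjacent negative bump. -/
theorem false_of_weak_bump (H : IsModifiedSolution a G C D u v h lam mu A)
    {η T Abar e γ R q s₁ s τ s' t₀ : ℝ} (hη : 0 < η)
    (hA : ∀ x y, x ≤ y → y - x ≤ T → ∫ z in x..y, |a z| ≤ Abar) (hA0 : 0 ≤ Abar)
    (hb₁ : IsBump η (fun x => -a x) s₁ s) (hb : IsBump η a s τ)
    (hb₂ : IsBump η (fun x => -a x) τ s') (hT : s' - s ≤ T)
    (ht₀ : t₀ ∈ Icc s τ) (hmax : ∀ x ∈ Icc s τ, u x ≤ u t₀)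
    (he : 0 ≤ e) (hle : ∀ x ∈ Icc s τ, C x * (lam * G (u x)) + D x ≤ e)
    (heM : e * Abar * T ≤ u t₀ / 2) (hq : q ≤ u t₀ / 2)
    (hγ0 : 0 ≤ γ) (hγ : ∀ y, q ≤ y → γ ≤ G y) (hmu : R < mu * γ * η ^ 2)
    (hR : ∀ t, u t < R) : False := by
  have hsτ : s < τ := by linarith [hb.le]
  have hu0 := H.nonneg t₀
  rcases ht₀.1.eq_or_lt with rfl | hlt
  · have := H.le_of_isBump_left (N := mu * γ) hη (mul_nonneg H.mu_nonneg hγ0)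
      (H.deriv_nonpos_of_isMaxOn hsτ hmax) hb₁ (fun x y => (H.integrable x y).neg)
      (H.nonpos_of_isBump_neg hb₁)
      (H.le_neg_mul_of_isBump_neg hb₁ fun y hy => hγ y (by linarith))
    linarith [hR s₁]
  · have hbound : e * Abar * (s' - t₀) ≤ u t₀ / 2 := by
      refine le_trans ?_ heM
      gcongr
      linarith
    have := H.le_of_isBump_right (s := t₀) (E := e * Abar) (N := mu * γ) hη (by positivity)
      (mul_nonneg H.mu_nonneg hγ0) ht₀.2
      (H.deriv_nonneg_of_isMaxOn hlt fun x hx => hmax x ⟨hx.1, hx.2.trans ht₀.2⟩) hb₂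
      (fun x y => (H.integrable x y).neg)
      (fun x hx => H.integral_le hA he hx.1 (by linarith [hx.2, hb₂.le])
        fun y hy => hle y ⟨hlt.le.trans hy.1, hy.2.trans hx.2⟩)
      (H.nonpos_of_isBump_neg hb₂)
      (H.le_neg_mul_of_isBump_neg hb₂ fun y hy => hγ y (by linarith))
    linarith [hR s']

/-- With the full nonlinearity switched on, a maximum on a positive bump cannot lie in a range
where the nonlinearity is strong. -/
theorem false_of_full_bump (H : IsModifiedSolution a G C D u v h lam mu A)
    {η T γ ρ s τ t₀ : ℝ} (hη : 0 < η) (hT0 : 0 < T) (hb : IsBump η a s τ)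
    (hT : τ - s ≤ T) (ht₀ : t₀ ∈ Icc s τ) (hmax : ∀ x ∈ Icc s τ, u x ≤ u t₀)
    (hC : ∀ x ∈ Icc s τ, C x = 1) (hM : ρ ≤ u t₀) (hM2 : u t₀ ≤ 2 * ρ) (hγ0 : 0 ≤ γ)
    (hγ : ∀ y ∈ Icc (ρ * η / T) (2 * ρ), γ ≤ G y) (hlam : 2 * ρ < lam * γ * η ^ 2 / 2) :
    False := by
  have h0 := H.nonneg_of_isBump hb
  obtain ⟨x, hx, hux⟩ := H.exists_le_of_isBump (K := lam * γ) hη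
    (mul_nonneg H.lam_nonneg hγ0) hb (H.integrable _ _) (fun x _ => H.nonneg x) h0 (by
      filter_upwards [hb.nonneg] with x hx hxm
      have hxm' : x ∈ Icc s τ := ⟨by linarith [hxm.1], by linarith [hxm.2]⟩
      have h1 := hx hxm'
      have h2 := H.mul_le_mul_of_concave hη hT (fun x _ => H.nonneg x) h0 ht₀ hxm
      have h3 : γ ≤ G (u x) := hγ _ ⟨by
        rw [div_le_iff₀ hT0]
        nlinarith, (hmax x hxm').trans hM2⟩
      rw [H.eq, max_eq_left h1, max_eq_right (by linarith : -a x ≤ 0), hC x hxm']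
      have h4 := mul_nonneg (H.D_mem x).1 h1
      have h5 := mul_le_mul_of_nonneg_left h3 (mul_nonneg H.lam_nonneg h1)
      linarith)
  linarith [hmax x hx]

/-- With the full forcing switched on, the maximum on a positive bump is large. -/
theorem false_of_forced_bump (H : IsModifiedSolution a G C D u v h lam mu A)
    {η ρ s τ t₀ : ℝ} (hη : 0 < η) (hA : 0 ≤ A) (hb : IsBump η a s τ)
    (hmax : ∀ x ∈ Icc s τ, u x ≤ u t₀)
    (hD : ∀ x ∈ Icc s τ, D x = A) (hM2 : u t₀ ≤ 2 * ρ) (hAη : 2 * ρ < A * η ^ 2 / 2) :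
    False := by
  obtain ⟨x, hx, hux⟩ := H.exists_le_of_isBump (K := A) hη hA hb (H.integrable _ _)
    (fun x _ => H.nonneg x) (H.nonneg_of_isBump hb) (by
      filter_upwards [hb.nonneg] with x hx hxm
      have hxm' : x ∈ Icc s τ := ⟨by linarith [hxm.1], by linarith [hxm.2]⟩
      have h1 := hx hxm'
      rw [H.eq, max_eq_left h1, max_eq_right (by linarith : -a x ≤ 0), hD x hxm']
      have h2 := H.G_nonneg (u x)
      have h3 := (H.C_mem x).1
      have h4 := H.lam_nonneg
      have : 0 ≤ C x * (lam * a x * G (u x)) := by positivity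
      linarith)
  linarith [hmax x hx]

end IsModifiedSolution

theorem sum_indicator_of_mem {ι α : Type*} [Fintype ι] {E : ι → Set α}
    (hdisj : Pairwise fun i j => Disjoint (E i) (E j)) (f : ι → ℝ) {j : ι} {t : α}
    (ht : t ∈ E j) : ∑ i, (E i).indicator (fun _ => f i) t = f j := by
  rw [Finset.sum_eq_single j, indicator_of_mem ht]
  · intro i _ hij
    exact indicator_of_notMem (fun hi => (hdisj hij).ne_of_mem hi ht rfl) _
  · simp

theorem sum_indicator_of_forall_notMem {ι α : Type*} [Fintype ι] {E : ι → Set α}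
    (f : ι → ℝ) {t : α} (ht : ∀ j, t ∉ E j) : ∑ i, (E i).indicator (fun _ => f i) t = 0 :=
  Finset.sum_eq_zero fun i _ => indicator_of_notMem (ht i) _

theorem sum_indicator_mem {ι α : Type*} [Fintype ι] {E : ι → Set α}
    (hdisj : Pairwise fun i j => Disjoint (E i) (E j)) {f : ι → ℝ} {s : Set ℝ} (h0 : 0 ∈ s)
    (hf : ∀ i, f i ∈ s) (t : α) : ∑ i, (E i).indicator (fun _ => f i) t ∈ s := by
  by_cases ht : ∃ j, t ∈ E j
  · obtain ⟨j, hj⟩ := ht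
    rw [sum_indicator_of_mem hdisj f hj]
    exact hf j
  · push Not at ht
    rwa [sum_indicator_of_forall_notMem f ht]

/-- Periodic solutions of a modified problem whose coefficients on each of the sets `E j` depend
continuously on the maximum of the solution over `[s j, t j]` and on a further parameter `p j`,
the latter being determined by a fixed point equation. -/
theorem exists_modified_solution {ι : Type*} [Fintype ι] {P : ℝ} (hP : 0 < P)
    {E : ι → Set ℝ} (hE : ∀ j, MeasurableSet (E j))
    (hdisj : Pairwise fun i j => Disjoint (E i) (E j))
    (hEper : ∀ j t, t + P ∈ E j ↔ t ∈ E j) {s t : ι → ℝ}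
    {a G : ℝ → ℝ} {lam mu A Gm γ R : ℝ}
    (ha : ∀ s t, IntervalIntegrable a volume s t) (ham : AEStronglyMeasurable a volume)
    (haper : Function.Periodic a P)
    (hG : Continuous G) (hG0 : ∀ x, 0 ≤ G x) (hGm : ∀ x, G x ≤ Gm)
    (hGneg : ∀ x, x ≤ 0 → G x = 0) (hGR : ∀ x, R ≤ x → G x = γ)
    (hlam : 0 ≤ lam) (hmu : 0 ≤ mu) (hA : 0 ≤ A)
    (hsign : (lam * γ + A) * ∫ x in (0 : ℝ)..P, max (a x) 0 <
      mu * γ * ∫ x in (0 : ℝ)..P, max (-a x) 0)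
    {c d e : ι → ℝ × ℝ → ℝ} (hc : ∀ j, Continuous (c j)) (hd : ∀ j, Continuous (d j))
    (he : ∀ j, Continuous (e j)) (hc01 : ∀ j x, c j x ∈ Icc 0 1)
    (hdA : ∀ j x, d j x ∈ Icc 0 A) {lo hi : ℝ} (helh : ∀ j x, e j x ∈ Icc lo hi) :
    ∃ (u v h C D : ℝ → ℝ) (p M : ι → ℝ), IsModifiedSolution a G C D u v h lam mu A ∧
      Function.Periodic u P ∧ (∀ j, M j = sSup (u '' Icc (s j) (t j))) ∧
      (∀ j, p j = e j (M j, p j)) ∧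
      (∀ j, ∀ x ∈ E j, C x = c j (M j, p j) ∧ D x = d j (M j, p j)) ∧
      ∀ x, (∀ j, x ∉ E j) → C x = 1 ∧ D x = 0 := by
  have : Fact (0 < P) := ⟨hP⟩
  set M : BoundedContinuousFunction (AddCircle P) ℝ → ι → ℝ := fun w j =>
    sSup ((fun y : ℝ => w (y : AddCircle P)) '' Icc (s j) (t j)) with hM
  have hMcont : Continuous M := by
    refine continuous_pi fun j => ?_
    refine isCompact_Icc.continuous_sSup
      (f := fun (w : BoundedContinuousFunction (AddCircle P) ℝ) (y : ℝ) => w (y : AddCircle P)) ?_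
    have h1 : Continuous fun q : BoundedContinuousFunction (AddCircle P) ℝ × AddCircle P =>
        q.1 q.2 := by fun_prop
    exact h1.comp (continuous_fst.prodMk ((AddCircle.continuous_mk' P).comp continuous_snd))
  set C : (BoundedContinuousFunction (AddCircle P) ℝ) × (ι → ℝ) → ℝ → ℝ := fun x y =>
    1 + ∑ j, (E j).indicator (fun _ => c j (M x.1 j, x.2 j) - 1) y with hC
  set D : (BoundedContinuousFunction (AddCircle P) ℝ) × (ι → ℝ) → ℝ → ℝ := fun x y =>
    ∑ j, (E j).indicator (fun _ => d j (M x.1 j, x.2 j)) y with hD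
  have hC01 : ∀ x y, C x y ∈ Icc 0 1 := fun x y => by
    have := sum_indicator_mem hdisj (f := fun j => c j (M x.1 j, x.2 j) - 1) (s := Icc (-1) 0)
      (by simp) (fun j => ⟨by linarith [(hc01 j (M x.1 j, x.2 j)).1],
        by linarith [(hc01 j (M x.1 j, x.2 j)).2]⟩) y
    exact ⟨by linarith [this.1], by linarith [this.2]⟩
  have hD0A : ∀ x y, D x y ∈ Icc 0 A := fun x y =>
    sum_indicator_mem hdisj (left_mem_Icc.2 hA) (fun j => hdA j _) y
  set h : (BoundedContinuousFunction (AddCircle P) ℝ) × (ι → ℝ) → ℝ → ℝ := fun x y =>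
    C x y * (lam * max (a y) 0 * G (x.1 (y : AddCircle P))) + D x y * max (a y) 0 -
      mu * max (-a y) 0 * G (x.1 (y : AddCircle P)) +
      max 0 (min 1 (-x.1 (y : AddCircle P))) with hh
  have hxcont : ∀ x : (BoundedContinuousFunction (AddCircle P) ℝ) × (ι → ℝ),
      Continuous fun y : ℝ => x.1 (y : AddCircle P) := fun x =>
    x.1.continuous.comp (AddCircle.continuous_mk' P)
  have hmeas : ∀ x, AEStronglyMeasurable (h x) volume := fun x => by
    have h1 : Measurable (C x) := by
      simp only [hC]
      exact measurable_const.add (Finset.measurable_fun_sum _ fun j _ =>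
        measurable_const.indicator (hE j))
    have h2 : Measurable (D x) := by
      simp only [hD]
      exact Finset.measurable_fun_sum _ fun j _ => measurable_const.indicator (hE j)
    have h3 := ham.aemeasurable
    have h4 : Measurable fun y : ℝ => x.1 (y : AddCircle P) := (hxcont x).measurable
    have h5 : Measurable fun y : ℝ => G (x.1 (y : AddCircle P)) := hG.measurable.comp h4
    have h6 : AEMeasurable (fun y => max (a y) 0) volume := h3.max aemeasurable_const
    have h7 : AEMeasurable (fun y => max (-a y) 0) volume := h3.neg.max aemeasurable_const
    have h8 : Measurable fun y : ℝ => max 0 (min 1 (-x.1 (y : AddCircle P))) :=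
      measurable_const.max (measurable_const.min h4.neg)
    exact ((((h1.aemeasurable.mul ((h6.const_mul lam).mul h5.aemeasurable)).add
      (h2.aemeasurable.mul h6)).sub ((h7.const_mul mu).mul h5.aemeasurable)).add
      h8.aemeasurable).aestronglyMeasurable
  have hcoe : ∀ y : ℝ, ((y + P : ℝ) : AddCircle P) = (y : AddCircle P) := fun y =>
    AddCircle.coe_add_period P y
  have hper : ∀ x, Function.Periodic (h x) P := fun x y => by
    have hind : ∀ (f : ι → ℝ) j, (E j).indicator (fun _ => f j) (y + P) =
        (E j).indicator (fun _ => f j) y := fun f j => by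
      by_cases hy : y ∈ E j
      · rw [indicator_of_mem hy, indicator_of_mem ((hEper j y).2 hy)]
      · rw [indicator_of_notMem hy, indicator_of_notMem (fun h => hy ((hEper j y).1 h))]
    have h1 : C x (y + P) = C x y := by
      simp only [hC]
      congr 1
      exact Finset.sum_congr rfl fun j _ => hind (fun j => c j (M x.1 j, x.2 j) - 1) j
    have h2 : D x (y + P) = D x y :=
      Finset.sum_congr rfl fun j _ => hind (fun j => d j (M x.1 j, x.2 j)) j
    simp only [hh, h1, h2, hcoe, haper y]
  have hGm0 : 0 ≤ Gm := (hG0 0).trans (hGm 0)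
  have hbound : ∀ x y, |h x y| ≤ (lam * Gm + A + mu * Gm) * |a y| + 1 := fun x y => by
    have h1 := hC01 x y
    have h2 := hD0A x y
    have h3 := hG0 (x.1 (y : AddCircle P))
    have h4 := hGm (x.1 (y : AddCircle P))
    have h5 : max (a y) 0 ≤ |a y| := max_le (le_abs_self _) (abs_nonneg _)
    have h6 : max (-a y) 0 ≤ |a y| := max_le (neg_le_abs _) (abs_nonneg _)
    have h7 : 0 ≤ max (a y) 0 := le_max_right _ _
    have h8 : 0 ≤ max (-a y) 0 := le_max_right _ _
    have h9 : max 0 (min 1 (-x.1 (y : AddCircle P))) ≤ 1 :=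
      max_le zero_le_one (min_le_left _ _)
    have h10 : 0 ≤ max 0 (min 1 (-x.1 (y : AddCircle P))) := le_max_left _ _
    have e1 : C x y * (lam * max (a y) 0 * G (x.1 (y : AddCircle P))) ≤
        1 * (lam * |a y| * Gm) := by
      have := h1.2
      gcongr
    have e1' : 0 ≤ C x y * (lam * max (a y) 0 * G (x.1 (y : AddCircle P))) := by
      have := h1.1
      positivity
    have e2 : D x y * max (a y) 0 ≤ A * |a y| := mul_le_mul h2.2 h5 h7 hA
    have e2' : 0 ≤ D x y * max (a y) 0 := mul_nonneg h2.1 h7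
    have e3 : mu * max (-a y) 0 * G (x.1 (y : AddCircle P)) ≤ mu * |a y| * Gm := by gcongr
    have e3' : 0 ≤ mu * max (-a y) 0 * G (x.1 (y : AddCircle P)) := by positivity
    have e4 : 0 ≤ mu * |a y| * Gm := by positivity
    have e5 : 0 ≤ lam * |a y| * Gm := by positivity
    have e6 : 0 ≤ A * |a y| := by positivity
    refine abs_le.2 ⟨?_, ?_⟩ <;> simp only [hh] <;> linarith
  have hbint : ∀ x y, IntervalIntegrable (fun y => (lam * Gm + A + mu * Gm) * |a y| + 1)
      volume x y := fun x y => ((ha x y).abs.const_mul _).add intervalIntegrable_const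
  have hint : ∀ x y z, IntervalIntegrable (h x) volume y z := fun x y z =>
    (hbint y z).mono_fun (hmeas x).restrict (Eventually.of_forall fun y =>
      (hbound x y).trans (le_abs_self _))
  have hcont : ∀ y, Continuous fun x => h x y := fun y => by
    have h1 : ∀ f : ι → ℝ × ℝ → ℝ, (∀ j, Continuous (f j)) → ∀ j,
        Continuous fun x : (BoundedContinuousFunction (AddCircle P) ℝ) × (ι → ℝ) =>
          (E j).indicator (fun _ => f j (M x.1 j, x.2 j)) y := fun f hf j => by
      by_cases hy : y ∈ E j
      · simp only [indicator_of_mem hy]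
        have := (continuous_apply j).comp (hMcont.comp continuous_fst :
          Continuous fun x : (BoundedContinuousFunction (AddCircle P) ℝ) × (ι → ℝ) => M x.1)
        exact (hf j).comp (this.prodMk ((continuous_apply j).comp continuous_snd))
      · simp only [indicator_of_notMem hy]
        exact continuous_const
    have h2 : Continuous fun x => C x y :=
      continuous_const.add (continuous_finsetSum _ fun j _ =>
        h1 (fun j q => c j q - 1) (fun j => (hc j).sub continuous_const) j)
    have h3 : Continuous fun x => D x y := continuous_finsetSum _ fun j _ => h1 d hd j
    have h4 : Continuous fun x : (BoundedContinuousFunction (AddCircle P) ℝ) × (ι → ℝ) =>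
        x.1 (y : AddCircle P) := by fun_prop
    have h5 := hG.comp h4
    simp only [Function.comp_def] at h5
    simp only [hh]
    fun_prop
  have hMΨ : Continuous fun (x : (BoundedContinuousFunction (AddCircle P) ℝ) × (ι → ℝ)) j =>
      e j (M x.1 j, x.2 j) := by
    refine continuous_pi fun j => (he j).comp (Continuous.prodMk ?_ ?_)
    · exact (continuous_apply j).comp (hMcont.comp continuous_fst)
    · exact (continuous_apply j).comp continuous_snd
  have hposint : ∀ x y, IntervalIntegrable (fun z => max (a z) 0) volume x y := fun x y =>
    ⟨(ha x y).1.sup (integrable_zero _ _ _), (ha x y).2.sup (integrable_zero _ _ _)⟩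
  have hnegint : ∀ x y, IntervalIntegrable (fun z => max (-a z) 0) volume x y := fun x y =>
    ⟨(ha x y).1.neg.sup (integrable_zero _ _ _), (ha x y).2.neg.sup (integrable_zero _ _ _)⟩
  obtain ⟨x, hx2, v, hv1, hv2⟩ := exists_periodic_solution (h := h) (X₀ := max R 1)
    (lo := fun _ => lo) (hi := fun _ => hi) hmeas hper hbound (hbint 0 P) hcont hMΨ
    (fun x => ⟨fun j => (helh j _).1, fun j => (helh j _).2⟩) (by positivity)
    (fun x hx => by
      have h1 : ∀ y, h x y ≤ (lam * γ + A) * max (a y) 0 - mu * γ * max (-a y) 0 := fun y => by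
        have h2 := hx y
        have h3 : 1 ≤ x.1 (y : AddCircle P) := (le_max_right _ _).trans h2
        have h4 : G (x.1 (y : AddCircle P)) = γ := hGR _ ((le_max_left _ _).trans h2)
        have h5 : max 0 (min 1 (-x.1 (y : AddCircle P))) = 0 :=
          max_eq_left ((min_le_right _ _).trans (by linarith))
        have h6 : 0 ≤ max (a y) 0 := le_max_right _ _
        have hγ : 0 ≤ γ := h4 ▸ hG0 _
        have e1 : C x y * (lam * max (a y) 0 * γ) ≤ 1 * (lam * max (a y) 0 * γ) := by
          have := (hC01 x y).2
          gcongr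
        have e2 : D x y * max (a y) 0 ≤ A * max (a y) 0 :=
          mul_le_mul_of_nonneg_right (hD0A x y).2 h6
        simp only [hh, h4, h5]
        linarith
      have h2 := intervalIntegral.integral_mono_on hP.le (hint x 0 P)
        (((hposint 0 P).const_mul (lam * γ + A)).sub ((hnegint 0 P).const_mul (mu * γ)))
        fun y _ => h1 y
      rw [intervalIntegral.integral_sub ((hposint 0 P).const_mul _)
        ((hnegint 0 P).const_mul _), intervalIntegral.integral_const_mul,
        intervalIntegral.integral_const_mul] at h2
      linarith)
    (fun x hx => by
      have h1 : ∀ y, 1 ≤ h x y := fun y => by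
        have h2 := hx y
        have h3 : x.1 (y : AddCircle P) ≤ -1 := h2.trans (neg_le_neg (le_max_right _ _))
        have h4 : G (x.1 (y : AddCircle P)) = 0 := hGneg _ (by linarith)
        have h5 : max 0 (min 1 (-x.1 (y : AddCircle P))) = 1 := by
          rw [min_eq_left (by linarith), max_eq_right zero_le_one]
        have e2 : 0 ≤ D x y * max (a y) 0 := mul_nonneg (hD0A x y).1 (le_max_right _ _)
        simp only [hh, h4, h5]
        linarith
      have h2 := intervalIntegral.integral_mono_on hP.le
        (intervalIntegrable_const (c := (1 : ℝ))) (hint x 0 P) fun y _ => h1 y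
      rw [intervalIntegral.integral_const, smul_eq_mul] at h2
      linarith)
  have H : IsSecondPrimitive (fun y : ℝ => x.1 (y : AddCircle P)) v (h x) :=
    ⟨hv1, hv2, hint x⟩
  have huper : Function.Periodic (fun y : ℝ => x.1 (y : AddCircle P)) P := fun y => by
    simp only [hcoe]
  have hnn : ∀ y : ℝ, 0 ≤ x.1 (y : AddCircle P) := H.nonneg_of_periodic hP huper fun y hy => by
    have e2 : 0 ≤ D x y * max (a y) 0 := mul_nonneg (hD0A x y).1 (le_max_right _ _)
    have e3 := le_max_right 0 (min 1 (-x.1 (y : AddCircle P)))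
    simp only [hh, hGneg _ hy.le]
    linarith
  refine ⟨_, v, h x, C x, D x, x.2, M x.1, ⟨H, hnn, hG0, hC01 x, hD0A x, hlam, hmu, ha, ?_⟩,
    huper, fun j => rfl, fun j => (congrFun hx2 j).symm, fun j y hy => ⟨?_, ?_⟩,
    fun y hy => ⟨?_, ?_⟩⟩
  · intro y
    have : max 0 (min 1 (-x.1 (y : AddCircle P))) = 0 :=
      max_eq_left ((min_le_right _ _).trans (by linarith [hnn y]))
    simp only [hh, this, add_zero]
  · simp only [hC, sum_indicator_of_mem hdisj (fun j => c j (M x.1 j, x.2 j) - 1) hy]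
    ring
  · simp only [hD, sum_indicator_of_mem hdisj (fun j => d j (M x.1 j, x.2 j)) hy]
  · simp only [hC, sum_indicator_of_forall_notMem (fun j => c j (M x.1 j, x.2 j) - 1) hy,
      add_zero]
  · simp only [hD, sum_indicator_of_forall_notMem (fun j => d j (M x.1 j, x.2 j)) hy]

theorem IsSecondPrimitive.eq_zero_of_eq_zero {u v h Q : ℝ → ℝ} (H : IsSecondPrimitive u v h)
    (hu : ∀ t, 0 ≤ u t) (hQ : ∀ s t, IntervalIntegrable Q volume s t) (hQ0 : ∀ t, 0 ≤ Q t)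
    {ε : ℝ} (hε : 0 < ε) (hle : ∀ t, u t < ε → |h t| ≤ Q t * u t) {t₀ : ℝ} (ht₀ : u t₀ = 0)
    (t : ℝ) : u t = 0 := by
  have hclosed : IsClosed {t | u t = 0} := isClosed_eq H.continuous continuous_const
  have hopen : IsOpen {t | u t = 0} := by
    refine isOpen_iff_mem_nhds.2 fun t₀ (ht₀ : u t₀ = 0) => ?_
    have hv0 : v t₀ = 0 := IsLocalMin.hasDerivAt_eq_zero
      (Eventually.of_forall fun t => by rw [ht₀]; exact hu t) (H.hasDerivAt t₀)
    have hF : Continuous fun x => ∫ y in t₀..x, Q y :=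
      intervalIntegral.continuous_primitive hQ t₀
    obtain ⟨δ₁, hδ₁, hball₁⟩ := Metric.eventually_nhds_iff.1
      (H.continuous.continuousAt.eventually_lt (continuousAt_const (y := ε))
        (by rw [ht₀]; exact hε : u t₀ < ε))
    obtain ⟨δ₂, hδ₂, hball₂⟩ := Metric.eventually_nhds_iff.1
      (hF.abs.continuousAt.eventually_lt (continuousAt_const (y := 1 / 2))
        (by simp : |∫ y in t₀..t₀, Q y| < 1 / 2))
    set δ := min 1 (min (δ₁ / 2) (δ₂ / 2)) with hδ
    have hδpos : 0 < δ := by positivity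
    have hδ1 : δ ≤ 1 := min_le_left _ _
    have hδ2 : δ < δ₁ := by
      have : δ ≤ δ₁ / 2 := (min_le_right _ _).trans (min_le_left _ _)
      linarith
    have hδ3 : δ < δ₂ := by
      have : δ ≤ δ₂ / 2 := (min_le_right _ _).trans (min_le_right _ _)
      linarith
    obtain ⟨z, hz, hzmax⟩ := (isCompact_closedBall t₀ δ).exists_isMaxOn
      ⟨t₀, Metric.mem_closedBall_self hδpos.le⟩ H.continuous.continuousOn
    have hvb : ∀ x ∈ Metric.closedBall t₀ δ, ‖v x‖ ≤ u z / 2 := fun x hx => by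
      have hsub : uIcc t₀ x ⊆ Metric.closedBall t₀ δ := by
        rw [Real.closedBall_eq_Icc] at hx ⊢
        exact uIcc_subset_Icc ⟨by linarith, by linarith⟩ hx
      have h1 : ‖∫ y in t₀..x, h y‖ ≤ |∫ y in t₀..x, Q y * u z| := by
        refine intervalIntegral.norm_integral_le_abs_of_norm_le ?_ ((hQ t₀ x).mul_const _)
        refine (ae_restrict_iff' measurableSet_uIoc).2 (Eventually.of_forall fun y hy => ?_)
        have hy' := hsub (uIoc_subset_uIcc hy)
        refine (hle y (hball₁ ((Metric.mem_closedBall.1 hy').trans_lt hδ2))).trans ?_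
        exact mul_le_mul_of_nonneg_left (hzmax hy') (hQ0 y)
      rw [intervalIntegral.integral_mul_const, abs_mul, abs_of_nonneg (hu z),
        Real.norm_eq_abs] at h1
      have h2 := hball₂ ((Metric.mem_closedBall.1 hx).trans_lt hδ3)
      have h3 := H.deriv_eq t₀ x
      rw [hv0, zero_sub] at h3
      rw [h3, norm_neg, Real.norm_eq_abs]
      nlinarith [hu z]
    have hub := Convex.norm_image_sub_le_of_norm_hasDerivWithin_le
      (fun x _ => (H.hasDerivAt x).hasDerivWithinAt) hvb (convex_closedBall t₀ δ)
      (Metric.mem_closedBall_self hδpos.le) hz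
    rw [ht₀, sub_zero, Real.norm_eq_abs, abs_of_nonneg (hu z)] at hub
    have hz' : ‖z - t₀‖ ≤ 1 := by
      rw [← dist_eq_norm]
      exact (Metric.mem_closedBall.1 hz).trans hδ1
    have hz0 : u z ≤ 0 := by nlinarith [hu z]
    filter_upwards [Metric.closedBall_mem_nhds t₀ hδpos] with x hx
    exact le_antisymm ((hzmax hx).trans hz0) (hu x)
  have := IsClopen.eq_univ ⟨hclosed, hopen⟩ ⟨t₀, ht₀⟩
  exact eq_univ_iff_forall.1 this t

/-- Truncation of a real number to `[lo, hi]`. -/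
noncomputable def truncate (lo hi x : ℝ) : ℝ := max lo (min hi x)

theorem continuous_truncate (lo hi : ℝ) : Continuous (truncate lo hi) := by
  unfold truncate
  fun_prop

theorem truncate_mem {lo hi : ℝ} (h : lo ≤ hi) (x : ℝ) : truncate lo hi x ∈ Icc lo hi :=
  ⟨le_max_left _ _, max_le h (min_le_left _ _)⟩

theorem truncate_of_mem {lo hi x : ℝ} (h1 : lo ≤ x) (h2 : x ≤ hi) : truncate lo hi x = x := by
  rw [truncate, min_eq_right h2, max_eq_right h1]

theorem truncate_of_le {lo hi x : ℝ} (h1 : x ≤ lo) : truncate lo hi x = lo :=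
  max_eq_left ((min_le_right _ _).trans h1)

theorem truncate_of_ge {lo hi x : ℝ} (h : lo ≤ hi) (h1 : hi ≤ x) : truncate lo hi x = hi := by
  rw [truncate, min_eq_left h1, max_eq_right h]

/-- Strength of the nonlinearity on a positive interval of type `κ`, in terms of the maximum
and of the parameter. -/
noncomputable def bumpFactor (κ : Fin 3) (r : ℝ) (x : ℝ × ℝ) : ℝ :=
  if κ = 0 then truncate 0 1 (2 - 2 * x.1 / r) else if κ = 1 then truncate 0 1 (1 + x.2) else 1

/-- Strength of the additional forcing on a positive interval of type `κ`. -/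
noncomputable def bumpForcing (κ : Fin 3) (ρ A : ℝ) (x : ℝ × ℝ) : ℝ :=
  if κ = 0 then 0 else if κ = 1 then truncate 0 A (x.2 - 1) else A * truncate 0 1 (2 - x.1 / ρ)

/-- Update rule for the parameter, steering the maximum on an interval of type `1` to a
prescribed value in `[r, ρ]`. -/
noncomputable def bumpUpdate (κ : Fin 3) (r ρ A : ℝ) (x : ℝ × ℝ) : ℝ :=
  if κ = 1 then truncate (-1) (A + 1) (x.2 + (r + (ρ - r) * truncate 0 1 x.2) - x.1) else 0

theorem continuous_bumpFactor (κ : Fin 3) (r : ℝ) : Continuous (bumpFactor κ r) := by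
  unfold bumpFactor
  split_ifs
  · exact (continuous_truncate _ _).comp (by fun_prop)
  · exact (continuous_truncate _ _).comp (by fun_prop)
  · exact continuous_const

theorem continuous_bumpForcing (κ : Fin 3) (ρ A : ℝ) : Continuous (bumpForcing κ ρ A) := by
  unfold bumpForcing
  split_ifs
  · exact continuous_const
  · exact (continuous_truncate _ _).comp (by fun_prop)
  · exact continuous_const.mul ((continuous_truncate _ _).comp (by fun_prop))

theorem continuous_bumpUpdate (κ : Fin 3) (r ρ A : ℝ) : Continuous (bumpUpdate κ r ρ A) := by
  unfold bumpUpdate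
  split_ifs
  · refine (continuous_truncate _ _).comp ?_
    have := (continuous_truncate 0 1).comp (continuous_snd : Continuous (Prod.snd : ℝ × ℝ → ℝ))
    simp only [Function.comp_def] at this
    fun_prop
  · exact continuous_const

theorem bumpFactor_mem (κ : Fin 3) (r : ℝ) (x : ℝ × ℝ) : bumpFactor κ r x ∈ Icc 0 1 := by
  unfold bumpFactor
  split_ifs
  · exact truncate_mem zero_le_one _
  · exact truncate_mem zero_le_one _
  · simp

theorem bumpForcing_mem (κ : Fin 3) (ρ : ℝ) {A : ℝ} (hA : 0 ≤ A) (x : ℝ × ℝ) :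
    bumpForcing κ ρ A x ∈ Icc 0 A := by
  unfold bumpForcing
  split_ifs
  · simpa using hA
  · exact truncate_mem hA _
  · have := truncate_mem zero_le_one (2 - x.1 / ρ)
    exact ⟨mul_nonneg hA this.1, by nlinarith [this.2]⟩

theorem bumpUpdate_mem (κ : Fin 3) (r ρ : ℝ) {A : ℝ} (hA : 0 ≤ A) (x : ℝ × ℝ) :
    bumpUpdate κ r ρ A x ∈ Icc (-1) (A + 1) := by
  unfold bumpUpdate
  split_ifs
  · exact truncate_mem (by linarith) _
  · exact ⟨by norm_num, by linarith⟩

/-- If the impossible configurations are excluded, the modifications are inactive and the maximum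
has the prescribed size. -/
theorem bump_dichotomy {κ : Fin 3} {r ρ A M p : ℝ} (hr : 0 < r) (hrρ : r < ρ) (hA : 0 < A)
    (hp : p = bumpUpdate κ r ρ A (M, p))
    (hweak : bumpForcing κ ρ A (M, p) = 0 → r / 2 ≤ M →
      M ≤ r ∨ bumpFactor κ r (M, p) = 0 → False)
    (hfull : bumpFactor κ r (M, p) = 1 → ρ ≤ M → M ≤ 2 * ρ → False)
    (hforced : bumpForcing κ ρ A (M, p) = A → M ≤ 2 * ρ → False) :
    bumpFactor κ r (M, p) = 1 ∧ bumpForcing κ ρ A (M, p) = 0 ∧ (κ = 0 → M < r) ∧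
      (κ = 1 → r < M ∧ M < ρ) ∧ (κ = 2 → ρ < M) := by
  have hρ : 0 < ρ := hr.trans hrρ
  obtain rfl | rfl | rfl : κ = 0 ∨ κ = 1 ∨ κ = 2 := by omega
  · simp only [bumpFactor, bumpForcing, if_true] at *
    have hM : M < r / 2 := by
      by_contra! hM
      refine hweak trivial hM ?_
      rcases le_total M r with h | h
      · exact Or.inl h
      · refine Or.inr (truncate_of_le ?_)
        rw [sub_nonpos, le_div_iff₀ hr]
        linarith
    refine ⟨truncate_of_ge zero_le_one ?_, trivial, fun _ => by linarith, by simp, by simp⟩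
    have : 2 * M / r ≤ 1 := by
      rw [div_le_one hr]
      linarith
    linarith
  · simp only [bumpFactor, bumpForcing, bumpUpdate, one_ne_zero, if_true, if_false] at *
    set w := p + (r + (ρ - r) * truncate 0 1 p) - M with hw
    have hs := truncate_mem (lo := 0) (hi := 1) zero_le_one p
    have hwp : w = p := by
      rcases le_total w (-1) with h1 | h1
      · rw [truncate_of_le h1] at hp
        have e1 : truncate 0 1 p = 0 := truncate_of_le (by linarith)
        rw [e1, mul_zero, add_zero] at hw
        refine (hweak (truncate_of_le (by linarith)) (by linarith) (Or.inr ?_)).elim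
        exact truncate_of_le (by linarith)
      · rcases le_total w (A + 1) with h2 | h2
        · rw [truncate_of_mem h1 h2] at hp
          exact hp.symm
        · rw [truncate_of_ge (by linarith) h2] at hp
          have e1 : truncate 0 1 p = 1 := truncate_of_ge zero_le_one (by linarith)
          rw [e1, mul_one] at hw
          exact (hforced (truncate_of_ge hA.le (by linarith)) (by linarith)).elim
    have hMs : M = r + (ρ - r) * truncate 0 1 p := by linarith
    have hp0 : 0 < p := by
      by_contra! h
      rw [truncate_of_le h, mul_zero, add_zero] at hMs
      exact hweak (truncate_of_le (by linarith)) (by linarith) (Or.inl hMs.le)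
    have hp1 : p < 1 := by
      by_contra! h
      rw [truncate_of_ge zero_le_one h, mul_one] at hMs
      exact hfull (truncate_of_ge zero_le_one (by linarith)) (by linarith) (by linarith)
    rw [truncate_of_mem hp0.le hp1.le] at hMs
    refine ⟨truncate_of_ge zero_le_one (by linarith), truncate_of_le (by linarith), by simp,
      fun _ => ⟨by nlinarith, by nlinarith⟩, by simp⟩
  · have h20 : (2 : Fin 3) ≠ 0 := by decide
    have h21 : (2 : Fin 3) ≠ 1 := by decide
    simp only [bumpFactor, bumpForcing, h20, h21, if_false] at *
    have hM : 2 * ρ < M := by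
      by_contra! h
      rcases le_total M ρ with h1 | h1
      · refine hforced ?_ h
        rw [truncate_of_ge zero_le_one, mul_one]
        have : M / ρ ≤ 1 := (div_le_one hρ).2 h1
        linarith
      · exact hfull trivial h1 h
    refine ⟨trivial, ?_, by simp, by simp, fun _ => by linarith⟩
    rw [truncate_of_le, mul_zero]
    rw [sub_nonpos, le_div_iff₀ hρ]
    exact hM.le

theorem le_of_interlacing {m : ℕ} {σ τ : ℕ → ℝ} (hστ : ∀ i, 1 ≤ i → i ≤ m → σ i < τ i)
    (hτσ : ∀ i, 1 ≤ i → i ≤ m → τ i < σ (i + 1)) {i j : ℕ} (hi : 1 ≤ i) (hij : i ≤ j)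
    (hj : j ≤ m + 1) : σ i ≤ σ j := by
  induction j, hij using Nat.le_induction with
  | base => exact le_rfl
  | succ n hn ih =>
    have h1 := hστ n (by omega) (by omega)
    have h2 := hτσ n (by omega) (by omega)
    linarith [ih (by omega)]

theorem exists_mem_Ico_of_mem_Ico {σ : ℕ → ℝ} {y : ℝ} {n : ℕ}
    (hy : y ∈ Ico (σ 1) (σ (n + 1))) : ∃ i, 1 ≤ i ∧ i ≤ n ∧ y ∈ Ico (σ i) (σ (i + 1)) := by
  induction n with
  | zero => exact absurd (hy.1.trans_lt hy.2) (lt_irrefl _)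
  | succ n ih =>
    rcases lt_or_ge y (σ (n + 1)) with h | h
    · obtain ⟨i, h1, h2, h3⟩ := ih ⟨hy.1, h⟩
      exact ⟨i, h1, by omega, h3⟩
    · exact ⟨n + 1, by omega, le_rfl, h, hy.2⟩

theorem index_le_of_mem_translates {T : ℝ} {m : ℕ} {σ τ : ℕ → ℝ}
    (hστ : ∀ i, 1 ≤ i → i ≤ m → σ i < τ i) (hτσ : ∀ i, 1 ≤ i → i ≤ m → τ i < σ (i + 1))
    (hσT : σ (m + 1) - σ 1 = T) (hT : 0 < T) {i i' ℓ ℓ' : ℕ} (hi : 1 ≤ i) (him : i ≤ m)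
    (hi' : 1 ≤ i') (him' : i' ≤ m) {x : ℝ} (hx : x ∈ Icc (σ i + ℓ * T) (τ i + ℓ * T))
    (hx' : x ∈ Icc (σ i' + ℓ' * T) (τ i' + ℓ' * T)) : ℓ' ≤ ℓ ∧ (ℓ = ℓ' → i' ≤ i) := by
  have h1 := hτσ i hi him
  constructor
  · by_contra! h
    have h2 := le_of_interlacing hστ hτσ (i := i + 1) (j := m + 1) (by omega) (by omega) le_rfl
    have h3 := le_of_interlacing hστ hτσ (i := 1) (j := i') le_rfl hi' (by omega)
    have h4 : ((ℓ : ℝ) + 1) * T ≤ ℓ' * T :=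
      mul_le_mul_of_nonneg_right (by exact_mod_cast h) hT.le
    linarith [hx.2, hx'.1]
  · rintro rfl
    by_contra! h
    have h2 := le_of_interlacing hστ hτσ (i := i + 1) (j := i') (by omega) h (by omega)
    linarith [hx.2, hx'.1]

theorem measurable_toIcoMod {P : ℝ} (hP : 0 < P) (c : ℝ) : Measurable (toIcoMod hP c) := by
  have : toIcoMod hP c = fun x => c + Int.fract ((x - c) / P) * P :=
    funext fun x => toIcoMod_eq_add_fract_mul hP c x
  rw [this]
  exact measurable_const.add ((measurable_fract.comp (by fun_prop)).mul_const _)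

/-- Positive solutions with prescribed sizes of the maxima, once all constants are fixed. -/
theorem exists_solution_of_constants {g a : ℝ → ℝ} {T : ℝ} {m : ℕ} {σ τ : ℕ → ℝ}
    (hg_cont : ContinuousOn g (Ici 0)) (hg_zero : g 0 = 0) (hg_pos : ∀ s : ℝ, 0 < s → 0 < g s)
    (hT : 0 < T) (hm : 1 ≤ m)
    (hστ : ∀ i, 1 ≤ i → i ≤ m → σ i < τ i) (hτσ : ∀ i, 1 ≤ i → i ≤ m → τ i < σ (i + 1))
    (hσT : σ (m + 1) - σ 1 = T) (ha_per : Function.Periodic a T)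
    (ha : ∀ s t, IntervalIntegrable a volume s t) (ham : AEStronglyMeasurable a volume)
    {η Abar ε e γ₁ γ₂ A r ρ R lam mu : ℝ} (hη : 0 < η)
    (hbump : ∀ i, 1 ≤ i → i ≤ m → IsBump η a (σ i) (τ i))
    (hbump' : ∀ i, 1 ≤ i → i ≤ m → IsBump η (fun x => -a x) (τ i) (σ (i + 1)))
    (hA0 : 0 ≤ Abar) (hA : ∀ x y, x ≤ y → y - x ≤ T → ∫ z in x..y, |a z| ≤ Abar)
    (hr : 0 < r) (hrρ : r < ρ) (hρR : 2 * ρ < R) (hlam : 0 < lam) (hmu : 0 < mu)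
    (hε : 0 ≤ ε) (hgε : ∀ s ∈ Icc 0 r, lam * g s ≤ ε * s) (hεA : ε * Abar * T ≤ 1 / 2)
    (he : 0 ≤ e) (hge : ∀ s ∈ Icc 0 R, lam * g s + A ≤ e) (heA : e * Abar * T ≤ R / 2)
    (hγ₁0 : 0 ≤ γ₁) (hγ₁ : ∀ y ∈ Icc (ρ * η / T) (2 * ρ), γ₁ ≤ g y)
    (hlamγ : 2 * ρ < lam * γ₁ * η ^ 2 / 2) (hApos : 0 < A) (hAη : 2 * ρ < A * η ^ 2 / 2)
    (hγ₂0 : 0 ≤ γ₂) (hγ₂ : ∀ y ∈ Icc (r / 4) R, γ₂ ≤ g y) (hmuγ : R < mu * γ₂ * η ^ 2)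
    (hsign : (lam * g R + A) * ∫ x in (0 : ℝ)..T, max (a x) 0 <
      mu * g R * ∫ x in (0 : ℝ)..T, max (-a x) 0)
    {k : ℕ} (hk : 1 ≤ k) {S : ℕ → Fin 3} (hS : ∃ j, 1 ≤ j ∧ j ≤ k * m ∧ S j ≠ 0) :
    ∃ u v : ℝ → ℝ, IsSolR (fun t => lam * max (a t) 0 - mu * max (-a t) 0) g u v ∧
      (∀ t, u (t + k * T) = u t) ∧ (∀ t, 0 < u t) ∧
      ∀ i, 1 ≤ i → i ≤ m → ∀ ℓ : ℕ, ℓ < k →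
        (S (i + ℓ * m) = 0 → sSup (u '' Icc (σ i + ℓ * T) (τ i + ℓ * T)) < r) ∧
        (S (i + ℓ * m) = 1 → r < sSup (u '' Icc (σ i + ℓ * T) (τ i + ℓ * T)) ∧
          sSup (u '' Icc (σ i + ℓ * T) (τ i + ℓ * T)) < ρ) ∧
        (S (i + ℓ * m) = 2 → ρ < sSup (u '' Icc (σ i + ℓ * T) (τ i + ℓ * T)) ∧
          sSup (u '' Icc (σ i + ℓ * T) (τ i + ℓ * T)) < R) := by
  have hρ : 0 < ρ := hr.trans hrρ
  have hR : 0 < R := by linarith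
  have hk0 : (0 : ℝ) < k := by exact_mod_cast hk
  have hP : 0 < (k : ℝ) * T := by positivity
  set G : ℝ → ℝ := fun x => g (truncate 0 R x) with hG
  have hgnn : ∀ s, 0 ≤ s → 0 ≤ g s := fun s hs => by
    rcases hs.eq_or_lt with rfl | h
    · exact hg_zero.ge
    · exact (hg_pos s h).le
  have htr : ∀ x, truncate 0 R x ∈ Icc 0 R := truncate_mem hR.le
  have hGeq : ∀ x ∈ Icc 0 R, G x = g x := fun x hx => by
    simp only [hG, truncate_of_mem hx.1 hx.2]
  have hGcont : Continuous G :=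
    hg_cont.comp_continuous (continuous_truncate 0 R) fun x => (htr x).1
  have hG0 : ∀ x, 0 ≤ G x := fun x => hgnn _ (htr x).1
  obtain ⟨Gm, hGm⟩ := isCompact_Icc.exists_bound_of_continuousOn
    (hg_cont.mono (Icc_subset_Ici_self : Icc 0 R ⊆ Ici 0))
  have hGγ₂ : ∀ y, r / 4 ≤ y → γ₂ ≤ G y := fun y hy => by
    refine hγ₂ _ ⟨?_, (htr y).2⟩
    exact le_max_of_le_right (le_min (by linarith) hy)
  -- Positions of the intervals.
  have hσ1 : ∀ i, 1 ≤ i → i ≤ m → σ 1 ≤ σ i := fun i h1 h2 =>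
    le_of_interlacing hστ hτσ le_rfl h1 (by omega)
  have hσm : ∀ i, 1 ≤ i → i ≤ m → σ (i + 1) ≤ σ (m + 1) := fun i h1 h2 =>
    le_of_interlacing hστ hτσ (by omega) (by omega) le_rfl
  have hlen : ∀ i, 1 ≤ i → i ≤ m → σ (i + 1) - σ i ≤ T := fun i h1 h2 => by
    linarith [hσ1 i h1 h2, hσm i h1 h2]
  have hper : ∀ z : ℤ, ∀ x, a (x + z * T) = a x := fun z x => ha_per.int_mul z x
  have hpern : ∀ z : ℤ, ∀ x, -a (x + z * T) = -a x := fun z x => by rw [hper]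
  have hleft : ∀ i, 1 ≤ i → i ≤ m → ∃ s₁, IsBump η (fun x => -a x) s₁ (σ i) := by
    intro i h1 h2
    obtain ⟨n, rfl⟩ : ∃ n, i = n + 1 := ⟨i - 1, by omega⟩
    rcases Nat.eq_zero_or_pos n with rfl | hn
    · refine ⟨τ m + ((-1 : ℤ) : ℝ) * T, ?_⟩
      have := (hbump' m hm le_rfl).add_period (hpern (-1))
      rwa [show σ (m + 1) + ((-1 : ℤ) : ℝ) * T = σ (0 + 1) by push_cast; linarith] at this
    · exact ⟨τ n, hbump' n hn (by omega)⟩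
  have hcover : ∀ t, ∃ s τ s', IsBump η a s τ ∧ IsBump η (fun x => -a x) τ s' ∧
      t ∈ Icc s s' ∧ s' - s ≤ T := by
    intro t
    have h1 := toIcoMod_mem_Ico hT (σ 1) t
    rw [show σ 1 + T = σ (m + 1) by linarith] at h1
    obtain ⟨i, hi1, him, hi⟩ := exists_mem_Ico_of_mem_Ico h1
    have h2 := toIcoMod_add_toIcoDiv_zsmul hT (σ 1) t
    rw [zsmul_eq_mul] at h2
    refine ⟨_, _, _, (hbump i hi1 him).add_period (hper (toIcoDiv hT (σ 1) t)),
      (hbump' i hi1 him).add_period (hpern (toIcoDiv hT (σ 1) t)), ⟨?_, ?_⟩, ?_⟩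
    · linarith [hi.1]
    · linarith [hi.2]
    · linarith [hlen i hi1 him]
  have hmemP : ∀ i, 1 ≤ i → i ≤ m → ∀ ℓ : ℕ, ℓ < k →
      ∀ x ∈ Icc (σ i + ℓ * T) (τ i + ℓ * T), x ∈ Ico (σ 1) (σ 1 + k * T) := by
    intro i h1 h2 ℓ hℓ x hx
    have h3 : 0 ≤ (ℓ : ℝ) * T := by positivity
    have h4 : ((ℓ : ℝ) + 1) * T ≤ k * T :=
      mul_le_mul_of_nonneg_right (by exact_mod_cast hℓ) hT.le
    exact ⟨by linarith [hx.1, hσ1 i h1 h2], by linarith [hx.2, hσm i h1 h2, hτσ i h1 h2]⟩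
  -- The modified problem.
  set I : Fin m × Fin k → Set ℝ := fun j =>
    Icc (σ (j.1 + 1) + (j.2 : ℕ) * T) (τ (j.1 + 1) + (j.2 : ℕ) * T) with hI
  set E : Fin m × Fin k → Set ℝ := fun j => toIcoMod hP (σ 1) ⁻¹' I j with hE
  have hIE : ∀ j, I j ⊆ E j := fun j x hx => by
    have := (toIcoMod_eq_self hP).2 (hmemP (j.1 + 1) (by omega) (by omega) j.2 j.2.2 x hx)
    rwa [hE, mem_preimage, this]
  have hdisj : Pairwise fun i j => Disjoint (E i) (E j) := by
    intro i j hij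
    refine Set.disjoint_left.2 fun x hx hx' => hij ?_
    have h1 := index_le_of_mem_translates hστ hτσ hσT hT (by omega) (by omega) (by omega)
      (by omega) hx hx'
    have h2 := index_le_of_mem_translates hστ hτσ hσT hT (by omega) (by omega) (by omega)
      (by omega) hx' hx
    have h3 := le_antisymm h2.1 h1.1
    have h4 := le_antisymm (h2.2 h3.symm) (h1.2 h3)
    exact Prod.ext (Fin.ext (by omega)) (Fin.ext h3)
  have haP : Function.Periodic a (k * T) := ha_per.nat_mul k
  have hscale : ∀ f : ℝ → ℝ, Function.Periodic f T → (∀ s t, IntervalIntegrable f volume s t) →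
      ∫ x in (0 : ℝ)..(k * T), f x = k * ∫ x in (0 : ℝ)..T, f x := fun f hf hfi => by
    have := hf.intervalIntegral_add_zsmul_eq k 0 hfi
    simpa using this
  have hposint : ∀ x y, IntervalIntegrable (fun z => max (a z) 0) volume x y := fun x y =>
    ⟨(ha x y).1.sup (integrable_zero _ _ _), (ha x y).2.sup (integrable_zero _ _ _)⟩
  have hnegint : ∀ x y, IntervalIntegrable (fun z => max (-a z) 0) volume x y := fun x y =>
    ⟨(ha x y).1.neg.sup (integrable_zero _ _ _), (ha x y).2.neg.sup (integrable_zero _ _ _)⟩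
  obtain ⟨u, v, h, C, D, p, M, H, huper, hM, hp, hCD, hCD'⟩ := exists_modified_solution
    (s := fun j : Fin m × Fin k => σ (j.1 + 1) + (j.2 : ℕ) * T)
    (t := fun j => τ (j.1 + 1) + (j.2 : ℕ) * T) (R := R) (γ := g R) (Gm := Gm) (mu := mu)
    (c := fun j => bumpFactor (S (j.1 + 1 + j.2 * m)) r)
    (d := fun j => bumpForcing (S (j.1 + 1 + j.2 * m)) ρ A)
    (e := fun j => bumpUpdate (S (j.1 + 1 + j.2 * m)) r ρ A) hP
    (fun j => measurable_toIcoMod hP (σ 1) measurableSet_Icc) hdisj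
    (fun j x => by simp only [mem_preimage, toIcoMod_add_right]) ha ham haP hGcont hG0
    (fun x => (le_abs_self _).trans (hGm _ (htr x)))
    (fun x hx => by simp only [hG, truncate_of_le hx, hg_zero])
    (fun x hx => by simp only [hG, truncate_of_ge hR.le hx]) hlam.le hmu.le hApos.le
    (by
      rw [hscale _ (fun x => by simp only [ha_per x]) hposint,
        hscale _ (fun x => by simp only [ha_per x]) hnegint]
      nlinarith)
    (fun j => continuous_bumpFactor _ _) (fun j => continuous_bumpForcing _ _ _)
    (fun j => continuous_bumpUpdate _ _ _ _) (fun j => bumpFactor_mem _ _)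
    (fun j => bumpForcing_mem _ _ hApos.le) (fun j => bumpUpdate_mem _ _ _ hApos.le)
  have huR : ∀ t, u t < R := H.lt_of_periodic hη hP huper hA hA0 hcover hR.le he
    (fun s => hge _ (htr s)) heA hγ₂0 (fun y hy => hGγ₂ y (by linarith)) hmuγ
  -- Size of the maxima.
  have hmain : ∀ j, ∃ t₀ ∈ I j, M j = u t₀ ∧
      bumpFactor (S (j.1 + 1 + j.2 * m)) r (M j, p j) = 1 ∧
      bumpForcing (S (j.1 + 1 + j.2 * m)) ρ A (M j, p j) = 0 ∧
      (S (j.1 + 1 + j.2 * m) = 0 → M j < r) ∧ (S (j.1 + 1 + j.2 * m) = 1 → r < M j ∧ M j < ρ) ∧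
      (S (j.1 + 1 + j.2 * m) = 2 → ρ < M j) := by
    intro j
    have hi1 : 1 ≤ (j.1 : ℕ) + 1 := by omega
    have him : (j.1 : ℕ) + 1 ≤ m := by omega
    obtain ⟨t₀, ht₀, hsup, hmax⟩ := isCompact_Icc.exists_sSup_image_eq_and_ge
      (nonempty_Icc.2 (by linarith [hστ _ hi1 him]) : (I j).Nonempty) H.continuous.continuousOn
    rw [← hM j] at hsup
    have hu0 := H.nonneg t₀
    have hb := (hbump _ hi1 him).add_period (hper j.2)
    have hb₂ := (hbump' _ hi1 him).add_period (hpern j.2)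
    obtain ⟨s₁, hs₁⟩ := hleft _ hi1 him
    have hb₁ := hs₁.add_period (hpern j.2)
    simp only [Int.cast_natCast] at hb hb₁ hb₂
    have hlen' := hlen _ hi1 him
    refine ⟨t₀, ht₀, hsup, bump_dichotomy hr hrρ hApos (hp j) ?_ ?_ ?_⟩
    · rw [hsup]
      intro hD hMr hor
      have huM : ∀ x ∈ I j, u x ∈ Icc 0 R := fun x _ => ⟨H.nonneg x, (huR x).le⟩
      have hC := (bumpFactor_mem (S (j.1 + 1 + j.2 * m)) r (u t₀, p j))
      refine H.false_of_weak_bump (e := ε * u t₀) (q := r / 4) hη hA hA0 hb₁ hb hb₂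
        (by linarith) ht₀ hmax (mul_nonneg hε hu0) (fun x hx => ?_) (by nlinarith) (by linarith)
        hγ₂0 hGγ₂ hmuγ huR
      obtain ⟨hCx, hDx⟩ := hCD j x (hIE j hx)
      rw [hsup] at hCx hDx
      rw [hCx, hDx, hD, add_zero, hGeq _ (huM x hx)]
      rcases hor with hle | h0
      · have h1 := hgε (u x) ⟨H.nonneg x, (hmax x hx).trans hle⟩
        have h2 := mul_nonneg hlam.le (hgnn _ (H.nonneg x))
        have h3 := mul_le_mul_of_nonneg_left (hmax x hx) hε
        nlinarith [hC.2]
      · rw [h0, zero_mul]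
        exact mul_nonneg hε hu0
    · rw [hsup]
      intro hC h1 h2
      refine H.false_of_full_bump (γ := γ₁) hη hT hb (by linarith [hτσ _ hi1 him]) ht₀ hmax
        (fun x hx => ?_) h1 h2 hγ₁0 (fun y hy => ?_) hlamγ
      · rw [(hCD j x (hIE j hx)).1, hsup, hC]
      · rw [hGeq y ⟨le_trans (by positivity) hy.1, by linarith [hy.2]⟩]
        exact hγ₁ y hy
    · rw [hsup]
      intro hD h2
      refine H.false_of_forced_bump hη hApos.le hb hmax (fun x hx => ?_) h2 hAη
      rw [(hCD j x (hIE j hx)).2, hsup, hD]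
  choose t₀ ht₀ hMt hfac hforc hM0 hM1 hM2 using hmain
  have hCD1 : ∀ x, C x = 1 ∧ D x = 0 := fun x => by
    by_cases hx : ∃ j, x ∈ E j
    · obtain ⟨j, hj⟩ := hx
      exact ⟨(hCD j x hj).1.trans (hfac j), (hCD j x hj).2.trans (hforc j)⟩
    · push Not at hx
      exact hCD' x hx
  have hheq : h = fun x => (lam * max (a x) 0 - mu * max (-a x) 0) * g (u x) := funext fun x => by
    rw [H.eq x, (hCD1 x).1, (hCD1 x).2, hGeq _ ⟨H.nonneg x, (huR x).le⟩]
    ring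
  have hindex : ∀ i, 1 ≤ i → i ≤ m → ∀ ℓ : ℕ, ℓ < k → ∃ j : Fin m × Fin k,
      (j.1 : ℕ) + 1 = i ∧ (j.2 : ℕ) = ℓ := fun i h1 h2 ℓ hℓ =>
    ⟨(⟨i - 1, by omega⟩, ⟨ℓ, hℓ⟩), by simp only; omega, rfl⟩
  refine ⟨u, v, ⟨H.hasDerivAt, fun s t => ?_⟩, huper, fun t => ?_, fun i h1 h2 ℓ hℓ => ?_⟩
  · rw [H.deriv_eq s t, hheq]
  · refine (H.nonneg t).lt_of_ne' fun hut => ?_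
    have hzero := H.toIsSecondPrimitive.eq_zero_of_eq_zero H.nonneg
      (Q := fun x => (lam * max (a x) 0 + mu * max (-a x) 0) * (ε / lam))
      (fun s t => (((hposint s t).const_mul lam).add ((hnegint s t).const_mul mu)).mul_const _)
      (fun x => by
        have h1 := le_max_right (a x) 0
        have h2 := le_max_right (-a x) 0
        positivity) hr (fun x hx => ?_) hut
    · obtain ⟨j, hj1, hjk, hSj⟩ := hS
      have hdiv : (j - 1) / m < k := (Nat.div_lt_iff_lt_mul (by omega)).2 (by omega)
      have hmod : (j - 1) % m < m := Nat.mod_lt _ (by omega)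
      have hdm := Nat.mod_add_div (j - 1) m
      set n : Fin m × Fin k := (⟨(j - 1) % m, hmod⟩, ⟨(j - 1) / m, hdiv⟩) with hn
      have hjn : (n.1 : ℕ) + 1 + n.2 * m = j := by
        simp only [hn]
        rw [mul_comm ((j - 1) / m) m]
        omega
      have hMn : M n = 0 := (hMt n).trans (hzero _)
      obtain h | h | h : S j = 0 ∨ S j = 1 ∨ S j = 2 := by omega
      · exact hSj h
      · have := hM1 n (by rw [hjn]; exact h)
        linarith
      · have := hM2 n (by rw [hjn]; exact h)
        linarith
    · have h3 := le_max_right (a x) 0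
      have h4 := le_max_right (-a x) 0
      have h5 := hgnn _ (H.nonneg x)
      have h6 : g (u x) ≤ ε / lam * u x := by
        rw [div_mul_eq_mul_div, le_div_iff₀ hlam, mul_comm]
        exact hgε _ ⟨H.nonneg x, hx.le⟩
      have h7 : |lam * max (a x) 0 - mu * max (-a x) 0| ≤
          lam * max (a x) 0 + mu * max (-a x) 0 := by
        have h8 : 0 ≤ lam * max (a x) 0 := by positivity
        have h9 : 0 ≤ mu * max (-a x) 0 := by positivity
        exact abs_le.2 ⟨by linarith, by linarith⟩
      rw [hheq, mul_assoc, abs_mul, abs_of_nonneg h5]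
      exact mul_le_mul h7 h6 h5 ((abs_nonneg _).trans h7)
  · obtain ⟨j, rfl, rfl⟩ := hindex i h1 h2 ℓ hℓ
    rw [← hM j]
    refine ⟨hM0 j, hM1 j, fun h => ⟨hM2 j h, ?_⟩⟩
    rw [hMt j]
    exact huR _

/-! ### Choice of the constants -/

theorem eventually_isBump {b : ℝ → ℝ} (hb : ∀ s t, IntervalIntegrable b volume s t) {s t : ℝ}
    (hst : s < t) (h0 : ∀ᵐ x, x ∈ Icc s t → 0 ≤ b x) (hpos : 0 < ∫ x in s..t, b x) :
    ∀ᶠ η in 𝓝[>] (0 : ℝ), IsBump η b s t := by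
  have hbm : ∀ s t, IntervalIntegrable (fun x => max (b x) 0) volume s t := fun s t =>
    ⟨(hb s t).1.pos_part, (hb s t).2.pos_part⟩
  have hF := intervalIntegral.continuous_primitive hbm 0
  have hcont : Continuous fun η : ℝ =>
      (∫ x in (0 : ℝ)..(t - η), max (b x) 0) - (∫ x in (0 : ℝ)..(s + η), max (b x) 0) - η :=
    ((hF.comp (continuous_const.sub continuous_id)).sub
      (hF.comp (continuous_const.add continuous_id))).sub continuous_id
  have hval : 0 < ∫ x in s..t, max (b x) 0 :=
    hpos.trans_le (intervalIntegral.integral_mono hst.le (hb s t) (hbm s t) fun x => le_max_left _ _)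
  have h1 : ∀ᶠ η in 𝓝 (0 : ℝ), 0 < (∫ x in (0 : ℝ)..(t - η), max (b x) 0) -
      (∫ x in (0 : ℝ)..(s + η), max (b x) 0) - η := by
    refine hcont.continuousAt.eventually (lt_mem_nhds ?_)
    simpa [intervalIntegral.integral_interval_sub_left (hbm 0 t) (hbm 0 s)] using hval
  have h2 : ∀ᶠ η in 𝓝 (0 : ℝ), s + η < t - η := by
    have hc : Continuous fun η : ℝ => t - η - (s + η) := by fun_prop
    filter_upwards [hc.continuousAt.eventually (lt_mem_nhds (a := 0) (by simpa using hst))] with η h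
    linarith
  filter_upwards [nhdsWithin_le_nhds h1, nhdsWithin_le_nhds h2] with η h1 h2
  rw [intervalIntegral.integral_interval_sub_left (hbm 0 _) (hbm 0 _)] at h1
  exact ⟨h2.le, h0, by linarith⟩

theorem exists_pos_le_of_continuousOn {g : ℝ → ℝ} (hg : ContinuousOn g (Ici 0))
    (hpos : ∀ s, 0 < s → 0 < g s) {c : ℝ} (hc : 0 < c) (d : ℝ) :
    ∃ γ, 0 < γ ∧ ∀ y ∈ Icc c d, γ ≤ g y := by
  rcases (Icc c d).eq_empty_or_nonempty with h | h
  · exact ⟨1, one_pos, by simp [h]⟩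
  · obtain ⟨x, hx, hmin⟩ := isCompact_Icc.exists_isMinOn h
      (hg.mono fun y hy => hc.le.trans hy.1)
    exact ⟨g x, hpos x (hc.trans_le hx.1), fun y hy => hmin hy⟩

theorem exists_small_of_tendsto_div_zero {g : ℝ → ℝ} (hg_zero : g 0 = 0)
    (hg0 : Tendsto (fun s => g s / s) (𝓝[>] 0) (𝓝 0)) {lam ε ρ : ℝ} (hlam : 0 < lam) (hε : 0 < ε)
    (hρ : 0 < ρ) : ∃ r, 0 < r ∧ r < ρ ∧ ∀ s ∈ Icc 0 r, lam * g s ≤ ε * s := by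
  have hev : ∀ᶠ s in 𝓝[>] (0 : ℝ), g s / s < ε / lam := hg0.eventually_lt_const (by positivity)
  obtain ⟨d, hd, hsub⟩ := (mem_nhdsGT_iff_exists_Ioo_subset).1 hev
  have hd : 0 < d := hd
  refine ⟨min d ρ / 2, by positivity, by linarith [min_le_right d ρ], fun s hs => ?_⟩
  rcases hs.1.eq_or_lt with rfl | h
  · simp [hg_zero]
  · have hlt : min d ρ / 2 < d := by linarith [min_le_left d ρ, lt_min hd hρ]
    have : g s / s < ε / lam := hsub ⟨h, hs.2.trans_lt hlt⟩
    rw [div_lt_div_iff₀ h hlam] at this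
    linarith

theorem exists_large_of_tendsto_div_zero {g : ℝ → ℝ} (hg : ContinuousOn g (Ici 0))
    (hginf : Tendsto (fun s => g s / s) atTop (𝓝 0)) {lam ε : ℝ} (A M : ℝ) (hlam : 0 < lam)
    (hε : 0 < ε) : ∃ R, M < R ∧ ∀ s ∈ Icc 0 R, lam * g s + A ≤ ε * R := by
  have hev : ∀ᶠ s in atTop, g s / s < ε / (2 * lam) := hginf.eventually_lt_const (by positivity)
  obtain ⟨s₀, hs₀, hlarge⟩ := (hev.and (eventually_gt_atTop 0)).exists_forall_of_atTop.imp
    fun s h => (⟨(h s le_rfl).2, fun t ht => (h t ht).1⟩ :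
      0 < s ∧ ∀ t ≥ s, g t / t < ε / (2 * lam))
  obtain ⟨B, hB⟩ := isCompact_Icc.exists_bound_of_continuousOn
    (hg.mono (Icc_subset_Ici_self : Icc 0 s₀ ⊆ Ici 0))
  have hB0 : 0 ≤ B := (norm_nonneg _).trans (hB 0 ⟨le_rfl, hs₀.le⟩)
  refine ⟨max (M + 1) (2 * (lam * B + |A|) / ε), (lt_add_one M).trans_le (le_max_left _ _),
    fun s hs => ?_⟩
  set R := max (M + 1) (2 * (lam * B + |A|) / ε)
  have hR : 2 * (lam * B + |A|) ≤ ε * R := by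
    have := (div_le_iff₀ hε).1 (le_max_right (M + 1) (2 * (lam * B + |A|) / ε))
    linarith
  have hlB : 0 ≤ lam * B := by positivity
  have hA := le_abs_self A
  rcases le_total s s₀ with h | h
  · have h1 : g s ≤ B := (le_abs_self _).trans (hB s ⟨hs.1, h⟩)
    have := mul_le_mul_of_nonneg_left h1 hlam.le
    linarith [abs_nonneg A]
  · have h1 := hlarge s h
    rw [div_lt_div_iff₀ (hs₀.trans_le h) (by positivity)] at h1
    have := mul_le_mul_of_nonneg_left hs.2 hε.le
    linarith

theorem stmt_12 (g a : ℝ → ℝ) (T : ℝ) (m : ℕ) (σ τ : ℕ → ℝ)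
    (hg_cont : ContinuousOn g (Ici 0)) (hg_zero : g 0 = 0)
    (hg_pos : ∀ s : ℝ, 0 < s → 0 < g s)
    (hg0 : Tendsto (fun s => g s / s) (nhdsWithin 0 (Ioi 0)) (nhds 0))
    (hginf : Tendsto (fun s => g s / s) atTop (nhds 0))
    (hT : 0 < T)
    (hm : 1 ≤ m)
    (hστ : ∀ i, 1 ≤ i → i ≤ m → σ i < τ i)
    (hτσ : ∀ i, 1 ≤ i → i ≤ m → τ i < σ (i + 1))
    (hσT : σ (m + 1) - σ 1 = T)
    (ha_per : ∀ t, a (t + T) = a t)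
    -- `T` is the minimal period of `a`
    (ha_min : ∀ T' : ℝ, 0 < T' → (∀ t, a (t + T') = a t) → T ≤ T')
    (ha_loc : LocallyIntegrable a)
    (ha_pos : ∀ i, 1 ≤ i → i ≤ m →
      (∀ᵐ t : ℝ ∂volume, t ∈ Icc (σ i) (τ i) → 0 ≤ a t) ∧
        0 < ∫ t in (σ i)..(τ i), a t)
    (ha_neg : ∀ i, 1 ≤ i → i ≤ m →
      (∀ᵐ t : ℝ ∂volume, t ∈ Icc (τ i) (σ (i + 1)) → a t ≤ 0) ∧
        (∫ t in (τ i)..(σ (i + 1)), a t) < 0) :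
    ∀ ρ : ℝ, 0 < ρ → ∃ lamStar : ℝ, 0 < lamStar ∧
      ∀ lam : ℝ, lamStar < lam → ∃ r R : ℝ, 0 < r ∧ r < ρ ∧ ρ < R ∧
        ∃ muStar : ℝ, 0 < muStar ∧ ∀ mu : ℝ, muStar < mu →
          ∀ k : ℕ, 2 ≤ k →
            ∀ S : ℕ → Fin 3, (∃ j, 1 ≤ j ∧ j ≤ k * m ∧ S j ≠ 0) →
              ∃ u v : ℝ → ℝ,
                IsSolR (fun t => lam * max (a t) 0 - mu * max (-a t) 0) g u v ∧
                (∀ t, u (t + k * T) = u t) ∧ (∀ t, 0 < u t) ∧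
                ∀ i, 1 ≤ i → i ≤ m → ∀ ℓ : ℕ, ℓ < k →
                  (S (i + ℓ * m) = 0 →
                    sSup (u '' Icc (σ i + ℓ * T) (τ i + ℓ * T)) < r) ∧
                  (S (i + ℓ * m) = 1 →
                    r < sSup (u '' Icc (σ i + ℓ * T) (τ i + ℓ * T)) ∧
                      sSup (u '' Icc (σ i + ℓ * T) (τ i + ℓ * T)) < ρ) ∧
                  (S (i + ℓ * m) = 2 →
                    ρ < sSup (u '' Icc (σ i + ℓ * T) (τ i + ℓ * T)) ∧
                      sSup (u '' Icc (σ i + ℓ * T) (τ i + ℓ * T)) < R) := by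
  have ha : ∀ s t, IntervalIntegrable a volume s t := fun s t =>
    (ha_loc.integrableOn_isCompact isCompact_uIcc).intervalIntegrable
  have hna : ∀ s t, IntervalIntegrable (fun x => -a x) volume s t := fun s t => (ha s t).neg
  have hbump_ev : ∀ᶠ η in 𝓝[>] (0 : ℝ), ∀ i ∈ Finset.Icc 1 m,
      IsBump η a (σ i) (τ i) ∧ IsBump η (fun x => -a x) (τ i) (σ (i + 1)) := by
    refine (Filter.eventually_all_finset _).2 fun i hi => ?_
    obtain ⟨h1, h2⟩ := Finset.mem_Icc.1 hi
    obtain ⟨hp, hp'⟩ := ha_pos i h1 h2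
    obtain ⟨hn, hn'⟩ := ha_neg i h1 h2
    refine (eventually_isBump ha (hστ i h1 h2) hp hp').and
      (eventually_isBump hna (hτσ i h1 h2) ?_ ?_)
    · filter_upwards [hn] with x hx hxm
      linarith [hx hxm]
    · rw [intervalIntegral.integral_neg]
      linarith
  obtain ⟨η, hbumps, hη⟩ := (hbump_ev.and self_mem_nhdsWithin).exists
  replace hη : 0 < η := hη
  have hbump : ∀ i, 1 ≤ i → i ≤ m → IsBump η a (σ i) (τ i) := fun i h1 h2 =>
    (hbumps i (Finset.mem_Icc.2 ⟨h1, h2⟩)).1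
  have hbump' : ∀ i, 1 ≤ i → i ≤ m → IsBump η (fun x => -a x) (τ i) (σ (i + 1)) :=
    fun i h1 h2 => (hbumps i (Finset.mem_Icc.2 ⟨h1, h2⟩)).2
  -- The mass of `|a|` over a period, and of the negative part of `a`.
  obtain ⟨Abar, hA0, hA⟩ : ∃ Abar : ℝ, 0 < Abar ∧
      ∀ x y, x ≤ y → y - x ≤ T → ∫ z in x..y, |a z| ≤ Abar := by
    have hper : Function.Periodic (fun z => |a z|) T := fun z => by simp only [ha_per z]
    refine ⟨(∫ z in (0 : ℝ)..T, |a z|) + 1, ?_, fun x y hxy hyT => ?_⟩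
    · linarith [intervalIntegral.integral_nonneg (μ := volume) hT.le fun z _ => abs_nonneg (a z)]
    · have h1 := hper.intervalIntegral_add_eq x 0
      rw [zero_add] at h1
      have h2 : ∫ z in x..y, |a z| ≤ ∫ z in x..(x + T), |a z| :=
        intervalIntegral.integral_mono_interval le_rfl hxy (by linarith)
          (Eventually.of_forall fun z => abs_nonneg (a z)) (ha _ _).abs
      linarith
  have hneg : 0 < ∫ x in (0 : ℝ)..T, max (-a x) 0 := by
    have hper : Function.Periodic (fun x => max (-a x) 0) T := fun x => by simp only [ha_per x]
    have hb := hbump' 1 le_rfl hm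
    have hlen := le_of_interlacing hστ hτσ (i := 1 + 1) (j := m + 1) (by omega) (by omega) le_rfl
    have hlt := hστ 1 le_rfl hm
    have h1 := hper.intervalIntegral_add_eq (τ 1 + η) 0
    rw [zero_add] at h1
    have h2 : ∫ x in (τ 1 + η)..(σ (1 + 1) - η), max (-a x) 0 ≤
        ∫ x in (τ 1 + η)..(τ 1 + η + T), max (-a x) 0 :=
      intervalIntegral.integral_mono_interval le_rfl hb.le (by linarith)
        (Eventually.of_forall fun x => le_max_right _ _)
        ⟨(hna _ _).1.pos_part, (hna _ _).2.pos_part⟩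
    linarith [hb.le_integral]
  intro ρ hρ
  obtain ⟨γ₁, hγ₁0, hγ₁⟩ := exists_pos_le_of_continuousOn hg_cont hg_pos
    (show 0 < ρ * η / T by positivity) (2 * ρ)
  refine ⟨4 * ρ / (γ₁ * η ^ 2), by positivity, fun lam hlamStar => ?_⟩
  have hlam : 0 < lam := lt_trans (by positivity) hlamStar
  have hlamγ : 2 * ρ < lam * γ₁ * η ^ 2 / 2 := by
    rw [div_lt_iff₀ (by positivity)] at hlamStar
    linarith
  set ε := 1 / (2 * Abar * T) with hε_def
  have hε : 0 < ε := by positivity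
  have hεA : ε * Abar * T = 1 / 2 := by
    rw [hε_def]
    field_simp
  set A := 8 * ρ / η ^ 2 with hA_def
  have hApos : 0 < A := by positivity
  have hAη : A * η ^ 2 = 8 * ρ := by
    rw [hA_def]
    field_simp
  obtain ⟨r, hr, hrρ, hgε⟩ := exists_small_of_tendsto_div_zero hg_zero hg0 hlam hε hρ
  obtain ⟨R, hρR, hge⟩ := exists_large_of_tendsto_div_zero hg_cont hginf A (2 * ρ) hlam hε
  have hR : 0 < R := by linarith
  obtain ⟨γ₂, hγ₂0, hγ₂⟩ := exists_pos_le_of_continuousOn hg_cont hg_pos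
    (show 0 < r / 4 by positivity) R
  have hgR := hg_pos R hR
  set P := ∫ x in (0 : ℝ)..T, max (a x) 0
  set N := ∫ x in (0 : ℝ)..T, max (-a x) 0
  refine ⟨r, R, hr, hrρ, by linarith, max (R / (γ₂ * η ^ 2)) ((lam * g R + A) * P / (g R * N)),
    lt_max_of_lt_left (by positivity), fun mu hmuStar k hk S hS => ?_⟩
  obtain ⟨hmu₁, hmu₂⟩ := max_lt_iff.1 hmuStar
  have hmu : 0 < mu := lt_trans (by positivity) hmu₁
  rw [div_lt_iff₀ (by positivity)] at hmu₁ hmu₂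
  exact exists_solution_of_constants hg_cont hg_zero hg_pos hT hm hστ hτσ hσT ha_per ha
    ha_loc.aestronglyMeasurable hη hbump hbump' hA0.le hA hr hrρ hρR hlam hmu hε.le hgε hεA.le
    (mul_nonneg hε.le hR.le) hge (by linear_combination R * hεA) hγ₁0.le hγ₁ hlamγ hApos (by linarith)
    hγ₂0.le hγ₂ (by linarith) (by linarith) (by omega) hS
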